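/- arXiv:1906.05524 — 2 statements merged into one kernel-verified Lean document; each statement's English description precedes it below -/
import Mathlib

section
/- Let N ≥ 2 and 0 < s < 1/2, and let 1̂_{B_1}(ξ) = ∫_{B_1} e^(-2πi⟨ξ,x⟩) dx be the Fourier transform of the indicator of the unit ball B_1 ⊂ ℝ^N. Then ∫_{ℝ^N} |ξ|^(2s) · |1̂_{B_1}(ξ)|² dξ = σ_{N-1} · Γ(1-2s) · Γ((N+2s)/2) / ( 2 · π^(2s) · Γ(1-s)² · Γ((N+2-2s)/2) ), where σ_{N-1} = 2π^(N/2)/Γ(N/2); in particular this integral is finite. -/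
open MeasureTheory Real
open scoped ENNReal FourierTransform
open Set in
lemma aux_gamma_lint {a r : ℝ} (ha : 0 < a) (hr : 0 < r) :
    ∫⁻ t in Ioi (0:ℝ), ENNReal.ofReal (t ^ (a - 1) * Real.exp (-(r * t)))
      = ENNReal.ofReal ((1 / r) ^ a * Gamma a) := by
  rw [← Real.integral_rpow_mul_exp_neg_mul_Ioi ha hr]
  rw [← ofReal_integral_eq_lintegral_ofReal]
  · have h := integrableOn_rpow_mul_exp_neg_mul_rpow (s := a - 1) (p := 1) (b := r) (by linarith)
      one_pos hr
    simpa [IntegrableOn] using h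
  · filter_upwards [ae_restrict_mem measurableSet_Ioi] with t ht
    have : (0:ℝ) < t := ht
    positivity

open Set in
lemma aux_C {s a : ℝ} (hs : 0 < s) (hs1 : s < 1) (ha : 0 ≤ a) :
    ∫⁻ t in Ioi (0:ℝ), ENNReal.ofReal (t ^ (-1 - s) * (1 - Real.exp (-(t * a))))
      = ENNReal.ofReal (Gamma (1 - s) / s * a ^ s) := by
  have h1 : ∀ t ∈ Ioi (0:ℝ), ENNReal.ofReal (t ^ (-1 - s) * (1 - Real.exp (-(t * a))))
      = ∫⁻ u in Ioc 0 a, ENNReal.ofReal (t ^ ((1 - s) - 1) * Real.exp (-(u * t))) := by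
    intro t ht
    have ht : (0:ℝ) < t := ht
    rw [← ofReal_integral_eq_lintegral_ofReal]
    · congr 1
      rw [← intervalIntegral.integral_of_le ha, intervalIntegral.integral_const_mul]
      have : ∫ u in (0:ℝ)..a, Real.exp (-(u * t)) = (1 - Real.exp (-(t * a))) / t := by
        have hd : ∀ u ∈ uIcc 0 a, HasDerivAt (fun u : ℝ => - Real.exp (-(u * t)) / t)
            (Real.exp (-(u * t))) u := by
          intro u _
          have := ((((hasDerivAt_id u).mul_const t).neg).exp.neg).div_const t
          refine HasDerivAt.congr_deriv this ?_
          simp only [id, Pi.neg_apply]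
          field_simp
        rw [intervalIntegral.integral_eq_sub_of_hasDerivAt hd
          (Continuous.intervalIntegrable (by fun_prop) _ _)]
        simp
        rw [mul_comm]; ring
      rw [this, show (1 - s - 1 : ℝ) = (-1 - s) + 1 by ring, rpow_add ht, rpow_one]
      field_simp
    · exact (Continuous.integrableOn_Ioc (by fun_prop))
    · filter_upwards with u
      positivity
  rw [setLIntegral_congr_fun measurableSet_Ioi h1, lintegral_lintegral_swap]
  · have h2 : ∀ u ∈ Ioc (0:ℝ) a, ∫⁻ t in Ioi (0:ℝ),
        ENNReal.ofReal (t ^ ((1 - s) - 1) * Real.exp (-(u * t)))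
        = ENNReal.ofReal (u ^ (s - 1) * Gamma (1 - s)) := by
      intro u hu
      rw [aux_gamma_lint (by linarith) hu.1]
      congr 2
      rw [one_div, ← rpow_neg_one, ← rpow_mul hu.1.le]
      congr 1; ring
    rw [setLIntegral_congr_fun measurableSet_Ioc h2, ← ofReal_integral_eq_lintegral_ofReal]
    · rw [← intervalIntegral.integral_of_le ha, intervalIntegral.integral_mul_const,
        integral_rpow (Or.inl (by linarith))]
      congr 1
      rw [show s - 1 + 1 = s by ring, zero_rpow hs.ne']
      ring
    · have := (intervalIntegral.intervalIntegrable_rpow' (a := 0) (b := a) (r := s - 1) (by linarith)).mul_const (Gamma (1 - s))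
      exact (intervalIntegrable_iff_integrableOn_Ioc_of_le ha).1 this
    · filter_upwards [ae_restrict_mem measurableSet_Ioc] with u hu
      have := hu.1
      have := Gamma_pos_of_pos (show 0 < 1 - s by linarith)
      positivity
  · apply Measurable.aemeasurable
    fun_prop

open Set in
lemma aux_inv {f : ℝ → ℝ≥0∞} :
    ∫⁻ t in Ioi (0:ℝ), ENNReal.ofReal (t ^ (-2 : ℝ)) * f t⁻¹ = ∫⁻ t in Ioi (0:ℝ), f t := by
  have himg : (fun t : ℝ => t⁻¹) '' Ioi 0 = Ioi 0 := by
    ext x; constructor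
    · rintro ⟨y, hy, rfl⟩; exact mem_Ioi.2 (inv_pos.2 (mem_Ioi.1 hy))
    · intro hx; exact ⟨x⁻¹, mem_Ioi.2 (inv_pos.2 (mem_Ioi.1 hx)), inv_inv x⟩
  conv_rhs => rw [← himg]
  rw [lintegral_image_eq_lintegral_abs_deriv_mul measurableSet_Ioi
    (f' := fun t => -(t^2)⁻¹)
    (fun x hx => (hasDerivAt_inv (ne_of_gt hx)).hasDerivWithinAt) inv_injective.injOn]
  refine setLIntegral_congr_fun measurableSet_Ioi fun t ht => ?_
  have ht : (0:ℝ) < t := ht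
  congr 2
  rw [abs_neg, abs_of_nonneg (by positivity), rpow_neg ht.le]
  norm_cast

open Set in
lemma aux_D {s b : ℝ} (N : ℕ) (hs : 0 < s) (hb : 0 < b) :
    ∫⁻ t in Ioi (0:ℝ), ENNReal.ofReal (t ^ (-1 - s) * ((π / t) ^ ((N:ℝ)/2) * Real.exp (-b / t)))
      = ENNReal.ofReal (π ^ ((N:ℝ)/2) * (b ^ (-(s + N / 2)) * Gamma (s + N / 2))) := by
  have h1 : ∀ t ∈ Ioi (0:ℝ), ENNReal.ofReal (t ^ (-1 - s) * ((π / t) ^ ((N:ℝ)/2) * Real.exp (-b / t)))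
      = ENNReal.ofReal (t ^ (-2 : ℝ)) * (ENNReal.ofReal (π ^ ((N:ℝ)/2)) *
        ENNReal.ofReal ((t⁻¹) ^ ((s + N / 2) - 1) * Real.exp (-(b * t⁻¹)))) := by
    intro t ht
    have ht : (0:ℝ) < t := ht
    rw [← ENNReal.ofReal_mul (by positivity), ← ENNReal.ofReal_mul (by positivity)]
    congr 1
    rw [div_rpow pi_pos.le ht.le, inv_rpow ht.le, ← rpow_neg ht.le, div_eq_mul_inv (π ^ _),
      ← rpow_neg ht.le, neg_div, div_eq_mul_inv b]
    have : t ^ (-1 - s) * t ^ (-((N:ℝ)/2)) = t ^ (-2:ℝ) * t ^ (-(s + N / 2 - 1)) := by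
      rw [← rpow_add ht, ← rpow_add ht]; congr 1; ring
    linear_combination (π ^ ((N:ℝ)/2) * Real.exp (-(b * t⁻¹))) * this
  rw [setLIntegral_congr_fun measurableSet_Ioi h1]
  rw [aux_inv (f := fun t => (ENNReal.ofReal (π ^ ((N:ℝ)/2)) *
        ENNReal.ofReal (t ^ ((s + N / 2) - 1) * Real.exp (-(b * t)))))]
  rw [lintegral_const_mul _ (by fun_prop), aux_gamma_lint (by positivity) hb,
    ← ENNReal.ofReal_mul (by positivity)]
  congr 3
  rw [one_div, inv_rpow hb.le, ← rpow_neg hb.le]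

open Set in
lemma aux_polar {N : ℕ} (hN : 1 ≤ N) {f : ℝ → ℝ≥0∞} (hf : Measurable f) :
    ∫⁻ x : EuclideanSpace ℝ (Fin N), f ‖x‖ =
      ((N : ℝ≥0∞) * volume (Metric.ball (0 : EuclideanSpace ℝ (Fin N)) 1)) *
        ∫⁻ r in Ioi (0:ℝ), ENNReal.ofReal (r ^ (N - 1)) * f r := by
  have : Nonempty (Fin N) := ⟨⟨0, hN⟩⟩
  set μ : Measure (EuclideanSpace ℝ (Fin N)) := volume with hμ
  have hmp := μ.measurePreserving_homeomorphUnitSphereProd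
  have h1 : ∫⁻ x, f ‖x‖ ∂μ = ∫⁻ x : ({(0)}ᶜ : Set (EuclideanSpace ℝ (Fin N))), f (‖x.1‖) ∂(μ.comap (↑)) := by
    rw [lintegral_subtype_comap (measurableSet_singleton _).compl (fun x => f ‖x‖),
      restrict_compl_singleton]
  rw [h1]
  have h2 := hmp.lintegral_comp (f := fun p => f (p.2 : ℝ)) (by fun_prop)
  simp only [homeomorphUnitSphereProd_apply_snd_coe] at h2
  rw [h2, lintegral_prod _ (by fun_prop)]
  simp only [lintegral_const, Measure.toSphere_apply_univ, finrank_euclideanSpace, Fintype.card_fin]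
  rw [mul_comm]
  congr 1
  rw [Measure.volumeIoiPow, lintegral_withDensity_eq_lintegral_mul _ (by fun_prop) (by fun_prop)]
  simp only [Pi.mul_apply]
  rw [lintegral_subtype_comap measurableSet_Ioi (fun r => ENNReal.ofReal (r ^ (N - 1)) * f r)]

/-- half-open slab -/
def slab {N : ℕ} (h : EuclideanSpace ℝ (Fin N)) : Set (EuclideanSpace ℝ (Fin N)) :=
  {x | ‖x‖ < 1 ∧ -(‖h‖ ^ 2 / 2) ≤ inner ℝ x h ∧ inner ℝ x h < ‖h‖ ^ 2 / 2}

/-- lens -/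
def lens {N : ℕ} (h : EuclideanSpace ℝ (Fin N)) : Set (EuclideanSpace ℝ (Fin N)) :=
  {x | ‖x‖ < 1 ∧ ‖h - x‖ < 1}

lemma measurableSet_slab {N : ℕ} (h : EuclideanSpace ℝ (Fin N)) : MeasurableSet (slab h) := by
  have m1 : MeasurableSet {x : EuclideanSpace ℝ (Fin N) | ‖x‖ < 1} :=
    measurableSet_lt (by fun_prop) (by fun_prop)
  have m2 : MeasurableSet {x : EuclideanSpace ℝ (Fin N) | -(‖h‖ ^ 2 / 2) ≤ inner ℝ x h} :=
    measurableSet_le (by fun_prop) (by fun_prop)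
  have m3 : MeasurableSet {x : EuclideanSpace ℝ (Fin N) | inner ℝ x h < ‖h‖ ^ 2 / 2} :=
    measurableSet_lt (by fun_prop) (by fun_prop)
  exact m1.inter (m2.inter m3)

lemma lens_add_slab {N : ℕ} (h : EuclideanSpace ℝ (Fin N)) :
    volume (lens h) + volume (slab h) = volume (Metric.ball (0 : EuclideanSpace ℝ (Fin N)) 1) := by
  set Cp : Set (EuclideanSpace ℝ (Fin N)) := {x | ‖x‖ < 1 ∧ ‖h‖ ^ 2 / 2 ≤ inner ℝ x h} with hCp
  set Cm : Set (EuclideanSpace ℝ (Fin N)) := {x | ‖x‖ < 1 ∧ inner ℝ x h < -(‖h‖ ^ 2 / 2)} with hCm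
  have mH : MeasurableSet {x : EuclideanSpace ℝ (Fin N) | ‖h‖ ^ 2 / 2 ≤ inner ℝ x h} :=
    measurableSet_le (by fun_prop) (by fun_prop)
  have mH' : MeasurableSet {x : EuclideanSpace ℝ (Fin N) | inner ℝ x h < -(‖h‖ ^ 2 / 2)} :=
    measurableSet_lt (by fun_prop) (by fun_prop)
  have key : ∀ x : EuclideanSpace ℝ (Fin N), ‖h - x‖ ^ 2 = ‖h‖ ^ 2 - 2 * inner ℝ x h + ‖x‖ ^ 2 := by
    intro x; rw [norm_sub_sq_real, real_inner_comm]
  have hl : volume (lens h) = volume Cp + volume Cm := by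
    rw [← measure_inter_add_sdiff (lens h) mH]
    congr 1
    · congr 1
      ext x
      simp only [lens, hCp, Set.mem_inter_iff, Set.mem_ofPred_eq]
      constructor
      · rintro ⟨⟨a, b⟩, c⟩; exact ⟨a, c⟩
      · rintro ⟨a, c⟩
        refine ⟨⟨a, ?_⟩, c⟩
        have := key x
        refine lt_of_le_of_lt ?_ a
        exact abs_le_of_sq_le_sq' (by linarith) (norm_nonneg _) |>.2
    · have e1 : lens h \ {x | ‖h‖ ^ 2 / 2 ≤ inner ℝ x h} = (fun x => x - h) ⁻¹' Cm := by
        ext x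
        simp only [lens, hCm, Set.mem_sdiff, Set.mem_ofPred_eq, Set.mem_preimage, not_le,
          inner_sub_left, real_inner_self_eq_norm_sq, norm_sub_rev x h]
        have := key x
        constructor
        · rintro ⟨⟨a, b⟩, c⟩; exact ⟨b, by linarith⟩
        · rintro ⟨a, c⟩
          refine ⟨⟨?_, a⟩, by linarith⟩
          refine lt_of_le_of_lt ?_ a
          exact abs_le_of_sq_le_sq' (by linarith) (norm_nonneg _) |>.2
      simp only [sub_eq_add_neg] at e1
      rw [e1, measure_preimage_add_right]
  have hb : volume (Metric.ball (0 : EuclideanSpace ℝ (Fin N)) 1) =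
      volume Cp + (volume Cm + volume (slab h)) := by
    rw [← measure_inter_add_sdiff _ mH, ← measure_inter_add_sdiff (_ \ _) mH']
    congr 1
    · congr 1
      ext x; simp [hCp]
    · congr 1
      · congr 1
        ext x; simp [hCm]
        have := sq_nonneg ‖h‖
        intros; linarith
      · congr 1
        ext x; simp [slab, and_assoc]
        tauto
  rw [hl, hb, add_assoc]

lemma exists_iso {N : ℕ} (u v : EuclideanSpace ℝ (Fin N)) (huv : ‖u‖ = ‖v‖) :
    ∃ T : EuclideanSpace ℝ (Fin N) ≃ₗᵢ[ℝ] EuclideanSpace ℝ (Fin N), T u = v :=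
  ⟨_, Submodule.reflection_sub huv⟩

lemma vol_slab_congr {N : ℕ} (u v : EuclideanSpace ℝ (Fin N)) (huv : ‖u‖ = ‖v‖) :
    volume (slab u) = volume (slab v) := by
  obtain ⟨T, rfl⟩ := exists_iso u v huv
  have : slab u = T ⁻¹' slab (T u) := by
    ext x; simp [slab]
  rw [this, T.measurePreserving.measure_preimage (measurableSet_slab _).nullMeasurableSet]

lemma aux_gauss1 {s : ℝ} (hs' : s < 1 / 2) :
    ∫ t : ℝ, |t| ^ (-2 * s) * Real.exp (- |t| ^ (2:ℝ)) = Gamma (1 / 2 - s) := by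
  rw [integral_comp_abs (f := fun t => t ^ (-2 * s) * Real.exp (- t ^ (2:ℝ))),
    integral_rpow_mul_exp_neg_rpow two_pos (by linarith)]
  rw [show (-2 * s + 1) / 2 = 1 / 2 - s by ring]
  ring

lemma aux_gaussN {N : ℕ} (i : Fin N) {s : ℝ} (hs' : s < 1 / 2) :
    ∫⁻ x : EuclideanSpace ℝ (Fin N), ENNReal.ofReal (|x i| ^ (-2 * s)) * ENNReal.ofReal (Real.exp (-‖x‖ ^ 2))
      = ENNReal.ofReal (Gamma (1 / 2 - s) * π ^ (((N : ℝ) - 1) / 2)) := by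
  let φ : Fin N → ℝ → ℝ := fun j t =>
    if j = i then |t| ^ (-2 * s) * Real.exp (- |t| ^ (2:ℝ)) else Real.exp (-1 * t ^ 2)
  have hφ : ∫ x : Fin N → ℝ, ∏ j, φ j (x j) = Gamma (1 / 2 - s) * π ^ (((N : ℝ) - 1) / 2) := by
    rw [integral_fintype_prod_volume_eq_prod]
    rw [← Finset.mul_prod_erase _ _ (Finset.mem_univ i)]
    congr 1
    · simp only [φ, if_true]; exact aux_gauss1 hs'
    · rw [Finset.prod_congr rfl (g := fun _ => √π)]
      · rw [Finset.prod_const, Finset.card_erase_of_mem (Finset.mem_univ i), Finset.card_univ,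
          Fintype.card_fin, ← rpow_natCast, sqrt_eq_rpow, ← rpow_mul pi_pos.le,
          Nat.cast_sub (by have := i.2; omega)]
        congr 1; push_cast; ring
      · intro j hj
        have := (Finset.mem_erase.1 hj).1
        simp only [φ, this, if_false]
        rw [integral_gaussian]; simp
  have hpos : 0 < Gamma (1 / 2 - s) * π ^ (((N : ℝ) - 1) / 2) :=
    mul_pos (Gamma_pos_of_pos (by linarith)) (by positivity)
  have hInt : Integrable (fun x : Fin N → ℝ => ∏ j, φ j (x j)) := by
    by_contra hc
    rw [integral_undef hc] at hφ
    linarith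
  have hφ0 : ∀ j t, 0 ≤ φ j t := by
    intro j t; simp only [φ]; split_ifs <;> positivity
  rw [← hφ, ofReal_integral_eq_lintegral_ofReal hInt
    (Filter.Eventually.of_forall fun x => Finset.prod_nonneg fun j _ => hφ0 _ _)]
  rw [← (EuclideanSpace.volume_preserving_symm_measurableEquiv_toLp (Fin N)).lintegral_comp_emb
    (MeasurableEquiv.measurableEmbedding _)]
  refine lintegral_congr fun x => ?_
  rw [← ENNReal.ofReal_mul (by positivity)]
  congr 1
  rw [← Finset.mul_prod_erase _ _ (Finset.mem_univ i), EuclideanSpace.norm_sq_eq,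
    ← Finset.add_sum_erase _ _ (Finset.mem_univ i), neg_add, Real.exp_add, ← mul_assoc]
  congr 1
  · simp [φ]
  · rw [← Finset.sum_neg_distrib, Real.exp_sum]
    refine Finset.prod_congr rfl fun j hj => ?_
    have := (Finset.mem_erase.1 hj).1
    simp [φ, this]

lemma aux_scale {N : ℕ} {f : EuclideanSpace ℝ (Fin N) → ℝ≥0∞} (hf : Measurable f) {R : ℝ} (hR : 0 < R) :
    ∫⁻ x, f x = ENNReal.ofReal (R ^ N) * ∫⁻ x, f (R • x) := by
  have h := Measure.map_addHaar_smul (volume : Measure (EuclideanSpace ℝ (Fin N))) hR.ne'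
  have h2 : ∫⁻ x, f (R • x) = ∫⁻ x, f x ∂(Measure.map (R • ·) volume) :=
    (lintegral_map hf (by fun_prop)).symm
  rw [h2, h, lintegral_smul_measure, finrank_euclideanSpace, Fintype.card_fin, smul_eq_mul,
    ← mul_assoc, ← ENNReal.ofReal_mul (by positivity), abs_of_pos (by positivity),
    mul_inv_cancel₀ (by positivity), ENNReal.ofReal_one, one_mul]

open Set in
lemma aux_F {N : ℕ} (i : Fin N) {s : ℝ} (hs' : s < 1 / 2) :
    ∫⁻ x in Metric.ball (0 : EuclideanSpace ℝ (Fin N)) 1, ENNReal.ofReal (|x i| ^ (-2 * s))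
      = ENNReal.ofReal (Gamma (1 / 2 - s) * π ^ (((N : ℝ) - 1) / 2) / Gamma ((N:ℝ) / 2 + 1 - s)) := by
  set J := ∫⁻ x in Metric.ball (0 : EuclideanSpace ℝ (Fin N)) 1, ENNReal.ofReal (|x i| ^ (-2 * s)) with hJ
  have hN : (1:ℝ) ≤ N := by exact_mod_cast (show 1 ≤ N by have := i.2; omega)
  have hG : 0 < Gamma ((N:ℝ) / 2 + 1 - s) := Gamma_pos_of_pos (by linarith)
  have hmF : Measurable fun x : EuclideanSpace ℝ (Fin N) => ENNReal.ofReal (|x i| ^ (-2 * s)) := by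
    fun_prop
  have hball : ∀ u : ℝ, 0 < u →
      ∫⁻ x in Metric.ball (0 : EuclideanSpace ℝ (Fin N)) (√u), ENNReal.ofReal (|x i| ^ (-2 * s))
        = ENNReal.ofReal (u ^ ((N:ℝ)/2 - s)) * J := by
    intro u hu
    have hu' := Real.sqrt_pos.2 hu
    rw [← lintegral_indicator measurableSet_ball,
      aux_scale (hmF.indicator measurableSet_ball) hu', hJ, ← lintegral_indicator measurableSet_ball]
    have : ∀ x : EuclideanSpace ℝ (Fin N),
        (Metric.ball (0 : EuclideanSpace ℝ (Fin N)) (√u)).indicator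
          (fun x => ENNReal.ofReal (|x i| ^ (-2 * s))) (√u • x) =
        ENNReal.ofReal (√u ^ (-2 * s)) * (Metric.ball (0 : EuclideanSpace ℝ (Fin N)) 1).indicator
          (fun x => ENNReal.ofReal (|x i| ^ (-2 * s))) x := by
      intro x
      by_cases hx : ‖x‖ < 1
      · rw [indicator_of_mem, indicator_of_mem]
        · rw [← ENNReal.ofReal_mul (by positivity), ← mul_rpow (by positivity) (by positivity)]
          simp [abs_mul, abs_of_pos hu']
        · simpa using hx
        · simp only [mem_ball_zero_iff, norm_smul, Real.norm_eq_abs, abs_of_pos hu']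
          nlinarith
      · rw [indicator_of_notMem, indicator_of_notMem]
        · simp
        · simpa using hx
        · simp only [mem_ball_zero_iff, norm_smul, Real.norm_eq_abs, abs_of_pos hu']
          push Not at hx ⊢
          nlinarith
    simp_rw [this]
    rw [lintegral_const_mul _ (hmF.indicator measurableSet_ball), ← mul_assoc,
      ← ENNReal.ofReal_mul (by positivity)]
    congr 2
    rw [← rpow_natCast, ← rpow_add hu', sqrt_eq_rpow, ← rpow_mul hu.le]
    congr 1; ring
  have hK : ENNReal.ofReal (Gamma (1 / 2 - s) * π ^ (((N : ℝ) - 1) / 2))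
      = ENNReal.ofReal (Gamma ((N:ℝ) / 2 + 1 - s)) * J := by
    rw [← aux_gaussN i hs']
    have h1 : ∀ x : EuclideanSpace ℝ (Fin N),
        ENNReal.ofReal (|x i| ^ (-2 * s)) * ENNReal.ofReal (Real.exp (-‖x‖ ^ 2))
        = ∫⁻ u in Ioi (0:ℝ), {p : EuclideanSpace ℝ (Fin N) × ℝ | ‖p.1‖ ^ 2 < p.2}.indicator
          (fun p => ENNReal.ofReal (|p.1 i| ^ (-2 * s)) * ENNReal.ofReal (Real.exp (-p.2))) (x, u) := by
      intro x
      have e1 : ∀ u : ℝ, {p : EuclideanSpace ℝ (Fin N) × ℝ | ‖p.1‖ ^ 2 < p.2}.indicator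
          (fun p => ENNReal.ofReal (|p.1 i| ^ (-2 * s)) * ENNReal.ofReal (Real.exp (-p.2))) (x, u)
          = (Ioi (‖x‖ ^ 2)).indicator (fun u => ENNReal.ofReal (|x i| ^ (-2 * s)) * ENNReal.ofReal (Real.exp (-u))) u := by
        intro u
        by_cases h : ‖x‖ ^ 2 < u <;> simp [indicator, h]
      simp_rw [e1]
      rw [lintegral_indicator measurableSet_Ioi, Measure.restrict_restrict measurableSet_Ioi,
        lintegral_const_mul _ (by fun_prop)]
      congr 1
      rw [inter_eq_left.2 (Ioi_subset_Ioi (by positivity)), ← ofReal_integral_eq_lintegral_ofReal,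
        integral_exp_neg_Ioi]
      · exact integrableOn_exp_neg_Ioi _
      · filter_upwards with u; positivity
    have hmS : MeasurableSet {p : EuclideanSpace ℝ (Fin N) × ℝ | ‖p.1‖ ^ 2 < p.2} :=
      measurableSet_lt (by fun_prop) (by fun_prop)
    simp_rw [h1]
    rw [lintegral_lintegral_swap]
    · have h2 : ∀ u ∈ Ioi (0:ℝ), ∫⁻ x : EuclideanSpace ℝ (Fin N), {p : EuclideanSpace ℝ (Fin N) × ℝ | ‖p.1‖ ^ 2 < p.2}.indicator
          (fun p => ENNReal.ofReal (|p.1 i| ^ (-2 * s)) * ENNReal.ofReal (Real.exp (-p.2))) (x, u)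
          = ENNReal.ofReal (u ^ (((N:ℝ)/2 + 1 - s) - 1) * Real.exp (-(1 * u))) * J := by
        intro u hu
        have hu : 0 < u := hu
        have e1 : ∀ x : EuclideanSpace ℝ (Fin N), {p : EuclideanSpace ℝ (Fin N) × ℝ | ‖p.1‖ ^ 2 < p.2}.indicator
          (fun p => ENNReal.ofReal (|p.1 i| ^ (-2 * s)) * ENNReal.ofReal (Real.exp (-p.2))) (x, u)
          = (Metric.ball (0 : EuclideanSpace ℝ (Fin N)) (√u)).indicator (fun x => ENNReal.ofReal (|x i| ^ (-2 * s)) * ENNReal.ofReal (Real.exp (-u))) x := by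
          intro x
          have : ‖x‖ < √u ↔ ‖x‖ ^ 2 < u := Real.lt_sqrt (norm_nonneg _)
          by_cases h : ‖x‖ ^ 2 < u <;> simp [indicator, h, this]
        simp_rw [e1]
        rw [lintegral_indicator measurableSet_ball, lintegral_mul_const _ hmF, hball u hu,
          mul_right_comm, ← ENNReal.ofReal_mul (by positivity)]
        congr 4
        · ring
        · ring
      rw [setLIntegral_congr_fun measurableSet_Ioi h2, lintegral_mul_const _ (by fun_prop),
        aux_gamma_lint (by linarith) one_pos]
      simp
    · apply Measurable.aemeasurable
      exact Measurable.indicator (by fun_prop) hmS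
  rw [ENNReal.ofReal_div_of_pos hG, hK, mul_comm, ENNReal.mul_div_cancel_right]
  · simpa using hG
  · simp

lemma aux_ae_ne {N : ℕ} (i : Fin N) : ∀ᵐ x : EuclideanSpace ℝ (Fin N), x i ≠ 0 := by
  have h : ∀ᵐ x : Fin N → ℝ, x i ≠ 0 := by
    have := Measure.pi_hyperplane (fun _ : Fin N => (volume : Measure ℝ)) i 0
    rw [ae_iff]
    simpa [volume_pi] using this
  exact (EuclideanSpace.volume_preserving_symm_measurableEquiv_toLp (Fin N)).quasiMeasurePreserving.ae h

lemma measurable_slab {N : ℕ} :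
    Measurable fun h : EuclideanSpace ℝ (Fin N) => volume (slab h) := by
  have m1 : MeasurableSet {p : EuclideanSpace ℝ (Fin N) × EuclideanSpace ℝ (Fin N) | ‖p.2‖ < 1} :=
    measurableSet_lt (by fun_prop) (by fun_prop)
  have m2 : MeasurableSet {p : EuclideanSpace ℝ (Fin N) × EuclideanSpace ℝ (Fin N) |
      -(‖p.1‖ ^ 2 / 2) ≤ inner ℝ p.2 p.1} :=
    measurableSet_le (by fun_prop) (by fun_prop)
  have m3 : MeasurableSet {p : EuclideanSpace ℝ (Fin N) × EuclideanSpace ℝ (Fin N) |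
      inner ℝ p.2 p.1 < ‖p.1‖ ^ 2 / 2} :=
    measurableSet_lt (by fun_prop) (by fun_prop)
  exact measurable_measure_prodMk_left (m1.inter (m2.inter m3))

open Set in
lemma aux_radial {s y : ℝ} (hs : 0 < s) (hy : y ≠ 0) :
    ∫⁻ r in Ioi (0:ℝ), {r : ℝ | -(r / 2) ≤ y ∧ y < r / 2}.indicator
      (fun r => ENNReal.ofReal (r ^ (-1 - 2 * s))) r
      = ENNReal.ofReal (2 ^ (-2 * s) / (2 * s)) * ENNReal.ofReal (|y| ^ (-2 * s)) := by
  have hm : MeasurableSet {r : ℝ | -(r / 2) ≤ y ∧ y < r / 2} := by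
    have m1 : MeasurableSet {r : ℝ | -(r / 2) ≤ y} := measurableSet_le (by fun_prop) (by fun_prop)
    have m2 : MeasurableSet {r : ℝ | y < r / 2} := measurableSet_lt (by fun_prop) (by fun_prop)
    exact m1.inter m2
  have hy' := abs_pos.2 hy
  rw [lintegral_indicator hm, Measure.restrict_restrict hm]
  have hset : ({r : ℝ | -(r / 2) ≤ y ∧ y < r / 2} ∩ Ioi 0 : Set ℝ) =ᵐ[volume] Ioi (2 * |y|) := by
    rcases lt_or_gt_of_ne hy with h | h
    · have : ({r : ℝ | -(r / 2) ≤ y ∧ y < r / 2} ∩ Ioi 0 : Set ℝ) = Ici (2 * |y|) := by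
        ext r
        simp only [mem_inter_iff, mem_ofPred_eq, mem_Ioi, mem_Ici, abs_of_neg h]
        constructor
        · rintro ⟨⟨a, b⟩, c⟩; linarith
        · intro a; refine ⟨⟨by linarith, by linarith⟩, by linarith⟩
      rw [this]; exact Ioi_ae_eq_Ici.symm
    · have : ({r : ℝ | -(r / 2) ≤ y ∧ y < r / 2} ∩ Ioi 0 : Set ℝ) = Ioi (2 * |y|) := by
        ext r
        simp only [mem_inter_iff, mem_ofPred_eq, mem_Ioi, abs_of_pos h]
        constructor
        · rintro ⟨⟨a, b⟩, c⟩; linarith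
        · intro a; refine ⟨⟨by linarith, by linarith⟩, by linarith⟩
      exact Filter.EventuallyEq.of_eq this
  rw [setLIntegral_congr hset, ← ofReal_integral_eq_lintegral_ofReal,
    integral_Ioi_rpow_of_lt (by linarith) (by positivity), ← ENNReal.ofReal_mul (by positivity)]
  · congr 1
    rw [show -1 - 2 * s + 1 = -2 * s by ring, mul_rpow (by norm_num) hy'.le]
    field_simp
  · exact integrableOn_Ioi_rpow_of_lt (by linarith) (by positivity)
  · filter_upwards [ae_restrict_mem measurableSet_Ioi] with r hr
    have : 0 < r := lt_trans (by positivity) hr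
    positivity

open Set in
lemma aux_E {N : ℕ} (i : Fin N) {s : ℝ} (hs : 0 < s) (hs' : s < 1 / 2) :
    ∫⁻ h : EuclideanSpace ℝ (Fin N), volume (slab h) * ENNReal.ofReal (‖h‖ ^ (-((N:ℝ) + 2 * s)))
      = ((N : ℝ≥0∞) * volume (Metric.ball (0 : EuclideanSpace ℝ (Fin N)) 1)) *
        (ENNReal.ofReal (2 ^ (-2 * s) / (2 * s)) *
        ENNReal.ofReal (Gamma (1 / 2 - s) * π ^ (((N : ℝ) - 1) / 2) / Gamma ((N:ℝ) / 2 + 1 - s))) := by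
  set e : EuclideanSpace ℝ (Fin N) := EuclideanSpace.single i 1 with he
  have hN : 1 ≤ N := by have := i.2; omega
  have hne : ‖e‖ = 1 := by simp [he]
  have h0 : ∀ h : EuclideanSpace ℝ (Fin N), volume (slab h) = volume (slab (‖h‖ • e)) := by
    intro h
    apply vol_slab_congr
    rw [norm_smul, hne, norm_norm, mul_one]
  have hmV : Measurable fun r : ℝ => volume (slab (r • e)) :=
    measurable_slab.comp (by fun_prop)
  have h1 : ∀ h : EuclideanSpace ℝ (Fin N), volume (slab h) * ENNReal.ofReal (‖h‖ ^ (-((N:ℝ) + 2 * s)))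
      = (fun r : ℝ => volume (slab (r • e)) * ENNReal.ofReal (r ^ (-((N:ℝ) + 2 * s)))) ‖h‖ := by
    intro h; simp only; rw [h0]
  rw [lintegral_congr h1, aux_polar hN (f := fun r : ℝ => volume (slab (r • e)) *
    ENNReal.ofReal (r ^ (-((N:ℝ) + 2 * s)))) (by fun_prop)]
  congr 1
  rw [← aux_F i hs']
  have h2 : ∀ r ∈ Ioi (0:ℝ), ENNReal.ofReal (r ^ (N - 1)) *
      (volume (slab (r • e)) * ENNReal.ofReal (r ^ (-((N:ℝ) + 2 * s))))
      = ∫⁻ x in Metric.ball (0 : EuclideanSpace ℝ (Fin N)) 1,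
        {p : ℝ × EuclideanSpace ℝ (Fin N) | -(p.1 / 2) ≤ p.2 i ∧ p.2 i < p.1 / 2}.indicator
          (fun p => ENNReal.ofReal (p.1 ^ (-1 - 2 * s))) (r, x) := by
    intro r hr
    have hr : 0 < r := hr
    have hm : MeasurableSet {x : EuclideanSpace ℝ (Fin N) | -(r / 2) ≤ x i ∧ x i < r / 2} := by
      have m1 : MeasurableSet {x : EuclideanSpace ℝ (Fin N) | -(r / 2) ≤ x i} :=
        measurableSet_le (by fun_prop) (by fun_prop)
      have m2 : MeasurableSet {x : EuclideanSpace ℝ (Fin N) | x i < r / 2} :=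
        measurableSet_lt (by fun_prop) (by fun_prop)
      exact m1.inter m2
    have e1 : ∀ x : EuclideanSpace ℝ (Fin N),
        {p : ℝ × EuclideanSpace ℝ (Fin N) | -(p.1 / 2) ≤ p.2 i ∧ p.2 i < p.1 / 2}.indicator
          (fun p => ENNReal.ofReal (p.1 ^ (-1 - 2 * s))) (r, x)
        = {x : EuclideanSpace ℝ (Fin N) | -(r / 2) ≤ x i ∧ x i < r / 2}.indicator
          (fun _ => ENNReal.ofReal (r ^ (-1 - 2 * s))) x := by
      intro x; simp [indicator]
    simp_rw [e1]
    rw [lintegral_indicator hm, Measure.restrict_restrict hm, setLIntegral_const]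
    have e2 : slab (r • e) = {x : EuclideanSpace ℝ (Fin N) | -(r / 2) ≤ x i ∧ x i < r / 2} ∩
        Metric.ball 0 1 := by
      ext x
      have hin : ∀ x : EuclideanSpace ℝ (Fin N), inner ℝ x e = x i := by
        intro x; simp [he, EuclideanSpace.inner_single_right]
      simp only [slab, mem_inter_iff, mem_ofPred_eq, mem_ball_zero_iff, norm_smul, hne, mul_one,
        Real.norm_eq_abs, sq_abs, inner_smul_right, hin]
      constructor
      · rintro ⟨a, b, c⟩
        refine ⟨⟨?_, ?_⟩, a⟩ <;> nlinarith
      · rintro ⟨⟨b, c⟩, a⟩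
        refine ⟨a, ?_, ?_⟩ <;> nlinarith
    rw [e2, mul_left_comm, ← ENNReal.ofReal_mul (by positivity), mul_comm]
    congr 2
    rw [← rpow_natCast, ← rpow_add hr, Nat.cast_sub hN]
    congr 1; push_cast; ring
  rw [setLIntegral_congr_fun measurableSet_Ioi h2, lintegral_lintegral_swap]
  · rw [← lintegral_const_mul _ (by fun_prop)]
    refine lintegral_congr_ae (ae_restrict_of_ae ?_)
    filter_upwards [aux_ae_ne i] with x hx
    rw [← aux_radial hs hx]
    refine lintegral_congr fun r => ?_
    simp [indicator]
  · apply Measurable.aemeasurable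
    have m1 : MeasurableSet {p : ℝ × EuclideanSpace ℝ (Fin N) | -(p.1 / 2) ≤ p.2 i} :=
        measurableSet_le (by fun_prop) (by fun_prop)
    have m2 : MeasurableSet {p : ℝ × EuclideanSpace ℝ (Fin N) | p.2 i < p.1 / 2} :=
        measurableSet_lt (by fun_prop) (by fun_prop)
    exact Measurable.indicator (by fun_prop) (m1.inter m2)

/-- the indicator of the ball -/
noncomputable def fB (N : ℕ) : EuclideanSpace ℝ (Fin N) → ℂ :=
  (Metric.ball (0 : EuclideanSpace ℝ (Fin N)) 1).indicator (fun _ => (1 : ℂ))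

/-- Gaussian kernel -/
noncomputable def gK {N : ℕ} (t : ℝ) (h : EuclideanSpace ℝ (Fin N)) : ℝ :=
  (π / t) ^ ((N : ℝ) / 2) * Real.exp (-(π ^ 2 * ‖h‖ ^ 2) / t)

lemma fB_integrable (N : ℕ) : Integrable (fB N) :=
  (integrable_indicator_iff measurableSet_ball).2
    (integrableOn_const (by exact measure_ball_lt_top.ne))

lemma fB_neg {N : ℕ} (x : EuclideanSpace ℝ (Fin N)) : fB N (-x) = fB N x := by
  simp [fB, Set.indicator]

lemma fB_hat_real {N : ℕ} (ξ : EuclideanSpace ℝ (Fin N)) :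
    (starRingEnd ℂ) (𝓕 (fB N) ξ) = 𝓕 (fB N) ξ := by
  rw [Real.fourier_eq', ← integral_conj, ← integral_neg_eq_self]
  refine integral_congr_ae (Filter.Eventually.of_forall fun v => ?_)
  simp only [smul_eq_mul, map_mul, ← Complex.exp_conj, fB_neg]
  congr 1
  · congr 1
    simp
    exact Or.inl (map_ofNat _ 2)
  · simp only [fB, Set.indicator]; split_ifs <;> simp

lemma fB_hat_sq {N : ℕ} (ξ : EuclideanSpace ℝ (Fin N)) :
    𝓕 (fB N) ξ * 𝓕 (fB N) ξ = ((‖𝓕 (fB N) ξ‖ ^ 2 : ℝ) : ℂ) := by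
  conv_lhs => rw [← fB_hat_real ξ]
  nth_rewrite 2 [← fB_hat_real ξ]
  rw [Complex.conj_conj, ← Complex.normSq_eq_conj_mul_self, Complex.normSq_eq_norm_sq]

open scoped Convolution in
lemma fB_conv {N : ℕ} (h : EuclideanSpace ℝ (Fin N)) :
    (fB N ⋆[ContinuousLinearMap.mul ℂ ℂ] fB N) h = ((volume.real (lens h) : ℝ) : ℂ) := by
  have hm : MeasurableSet (lens h) := by
    have m1 : MeasurableSet {x : EuclideanSpace ℝ (Fin N) | ‖x‖ < 1} :=
      measurableSet_lt (by fun_prop) (by fun_prop)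
    have m2 : MeasurableSet {x : EuclideanSpace ℝ (Fin N) | ‖h - x‖ < 1} :=
      measurableSet_lt (by fun_prop) (by fun_prop)
    exact m1.inter m2
  rw [convolution_def]
  have : ∀ x, (ContinuousLinearMap.mul ℂ ℂ) (fB N x) (fB N (h - x))
      = (lens h).indicator (fun _ => (1:ℂ)) x := by
    intro x
    by_cases h1 : ‖x‖ < 1 <;> by_cases h2 : ‖h - x‖ < 1 <;> simp [fB, lens, Set.indicator, h1, h2]
  simp_rw [this]
  rw [integral_indicator hm]
  simp

lemma gK_nonneg {N : ℕ} {t : ℝ} (ht : 0 < t) (h : EuclideanSpace ℝ (Fin N)) : 0 ≤ gK t h := by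
  unfold gK; positivity

lemma gK_cont {N : ℕ} (t : ℝ) : Continuous (gK t : EuclideanSpace ℝ (Fin N) → ℝ) := by
  unfold gK; fun_prop

lemma gK_integral {N : ℕ} {t : ℝ} (ht : 0 < t) :
    ∫ h : EuclideanSpace ℝ (Fin N), gK t h = 1 := by
  unfold gK
  rw [integral_const_mul]
  have h1 : ∀ h : EuclideanSpace ℝ (Fin N), Real.exp (-(π ^ 2 * ‖h‖ ^ 2) / t)
      = Real.exp (-(π ^ 2 / t) * ‖h‖ ^ 2) := by intro h; congr 1; ring
  simp_rw [h1]
  rw [GaussianFourier.integral_rexp_neg_mul_sq_norm (by positivity), finrank_euclideanSpace,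
    Fintype.card_fin, ← mul_rpow (by positivity) (by positivity)]
  have : π / t * (π / (π ^ 2 / t)) = 1 := by field_simp
  rw [this, one_rpow]

lemma gK_integrable {N : ℕ} {t : ℝ} (ht : 0 < t) :
    Integrable (gK t : EuclideanSpace ℝ (Fin N) → ℝ) := by
  by_contra hc
  have := gK_integral (N := N) ht
  rw [integral_undef hc] at this
  norm_num at this

lemma lens_le {N : ℕ} (h : EuclideanSpace ℝ (Fin N)) :
    volume (lens h) ≤ volume (Metric.ball (0 : EuclideanSpace ℝ (Fin N)) 1) := by
  rw [← lens_add_slab h]; exact le_self_add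

lemma lens_ne_top {N : ℕ} (h : EuclideanSpace ℝ (Fin N)) : volume (lens h) ≠ ∞ :=
  ((lens_le h).trans_lt measure_ball_lt_top).ne

open scoped Convolution in
lemma lens_integrable {N : ℕ} :
    Integrable fun h : EuclideanSpace ℝ (Fin N) => ((volume.real (lens h) : ℝ) : ℂ) := by
  have := (fB_integrable N).integrable_convolution (ContinuousLinearMap.mul ℂ ℂ) (fB_integrable N)
  refine this.congr (Filter.Eventually.of_forall fun h => ?_)
  exact fB_conv h

open scoped Convolution in
lemma gauss_identity_complex {N : ℕ} {t : ℝ} (ht : 0 < t) :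
    ∫ ξ : EuclideanSpace ℝ (Fin N), ((‖𝓕 (fB N) ξ‖ ^ 2 : ℝ) : ℂ) * Complex.exp (-(t:ℂ) * ‖ξ‖ ^ 2)
     = ∫ h : EuclideanSpace ℝ (Fin N), ((volume.real (lens h) : ℝ) : ℂ) * ((gK t h : ℝ) : ℂ) := by
  have J : Integrable (fun w : EuclideanSpace ℝ (Fin N) ↦ Complex.exp (-(t:ℂ) * ‖w‖ ^ 2)) := by
    simpa using GaussianFourier.integrable_cexp_neg_mul_sq_norm_add (V := EuclideanSpace ℝ (Fin N))
      (b := t) (by simpa using ht) 0 0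
  have key : ∫ ξ : EuclideanSpace ℝ (Fin N),
      𝓕 (fun h : EuclideanSpace ℝ (Fin N) => ((volume.real (lens h) : ℝ) : ℂ)) ξ • Complex.exp (-(t:ℂ) * ‖ξ‖ ^ 2)
      = ∫ h : EuclideanSpace ℝ (Fin N), ((volume.real (lens h) : ℝ) : ℂ) •
        𝓕 (fun w : EuclideanSpace ℝ (Fin N) ↦ Complex.exp (-(t:ℂ) * ‖w‖ ^ 2)) h := by
    simpa using! (VectorFourier.integral_fourierIntegral_smul_eq_flip (L := innerₗ (EuclideanSpace ℝ (Fin N)))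
      Real.continuous_fourierChar continuous_inner lens_integrable J)
  have e1 : ∀ ξ, 𝓕 (fun h : EuclideanSpace ℝ (Fin N) => ((volume.real (lens h) : ℝ) : ℂ)) ξ
      = ((‖𝓕 (fB N) ξ‖ ^ 2 : ℝ) : ℂ) := by
    intro ξ
    have this : (fun h : EuclideanSpace ℝ (Fin N) => ((volume.real (lens h) : ℝ) : ℂ))
        = (fB N ⋆[ContinuousLinearMap.mul ℂ ℂ] fB N) := funext fun h => (fB_conv h).symm
    rw [← fB_hat_sq, ← Real.fourier_mul_convolution_eq (fB_integrable N) (fB_integrable N), this]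
  have e2 : ∀ h : EuclideanSpace ℝ (Fin N),
      𝓕 (fun w : EuclideanSpace ℝ (Fin N) ↦ Complex.exp (-(t:ℂ) * ‖w‖ ^ 2)) h = ((gK t h : ℝ) : ℂ) := by
    intro h
    rw [fourier_gaussian_innerProductSpace (by simpa using ht), finrank_euclideanSpace,
      Fintype.card_fin, gK]
    push_cast
    rw [Complex.ofReal_cpow (by positivity)]
    push_cast
    ring_nf
  simp_rw [e1, e2, smul_eq_mul] at key
  exact key

lemma fhat_bdd {N : ℕ} (ξ : EuclideanSpace ℝ (Fin N)) : ‖𝓕 (fB N) ξ‖ ≤ ∫ x, ‖fB N x‖ :=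
  VectorFourier.norm_fourierIntegral_le_integral_norm _ _ _ _ _

lemma fhat_cont {N : ℕ} : Continuous (𝓕 (fB N)) :=
  VectorFourier.fourierIntegral_continuous Real.continuous_fourierChar
    (by exact continuous_inner) (fB_integrable N)

lemma lens_meas {N : ℕ} : Measurable fun h : EuclideanSpace ℝ (Fin N) => volume (lens h) := by
  have : (fun h : EuclideanSpace ℝ (Fin N) => volume (lens h)) = fun h =>
      volume (Metric.ball (0 : EuclideanSpace ℝ (Fin N)) 1) - volume (slab h) := by
    ext h
    rw [← lens_add_slab h, ENNReal.add_sub_cancel_right]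
    have : volume (slab h) ≤ volume (Metric.ball (0 : EuclideanSpace ℝ (Fin N)) 1) := by
      rw [← lens_add_slab h]; exact le_add_self
    exact (this.trans_lt measure_ball_lt_top).ne
  rw [this]
  exact measurable_const.sub measurable_slab

lemma gauss_identity_real {N : ℕ} {t : ℝ} (ht : 0 < t) :
    ∫ ξ : EuclideanSpace ℝ (Fin N), ‖𝓕 (fB N) ξ‖ ^ 2 * Real.exp (-(t * ‖ξ‖ ^ 2))
     = ∫ h : EuclideanSpace ℝ (Fin N), volume.real (lens h) * gK t h := by
  have h := gauss_identity_complex (N := N) ht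
  have e : ∀ ξ : EuclideanSpace ℝ (Fin N), ((‖𝓕 (fB N) ξ‖ ^ 2 : ℝ) : ℂ) * Complex.exp (-(t:ℂ) * ‖ξ‖ ^ 2)
    = ((‖𝓕 (fB N) ξ‖ ^ 2 * Real.exp (-(t * ‖ξ‖ ^ 2)) : ℝ) : ℂ) := by
    intro ξ; push_cast; rw [neg_mul]
  simp_rw [e, ← Complex.ofReal_mul] at h
  rw [integral_complex_ofReal, integral_complex_ofReal] at h
  exact_mod_cast h

lemma gauss_identity {N : ℕ} {t : ℝ} (ht : 0 < t) :
    ∫⁻ ξ : EuclideanSpace ℝ (Fin N), ENNReal.ofReal (‖𝓕 (fB N) ξ‖ ^ 2 * Real.exp (-(t * ‖ξ‖ ^ 2)))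
     = ∫⁻ h : EuclideanSpace ℝ (Fin N), volume (lens h) * ENNReal.ofReal (gK t h) := by
  have i1 : Integrable fun ξ : EuclideanSpace ℝ (Fin N) => ‖𝓕 (fB N) ξ‖ ^ 2 * Real.exp (-(t * ‖ξ‖ ^ 2)) := by
    have J : Integrable (fun w : EuclideanSpace ℝ (Fin N) ↦ Real.exp (-(t * ‖w‖ ^ 2))) := by
      by_contra hc
      have := GaussianFourier.integral_rexp_neg_mul_sq_norm (V := EuclideanSpace ℝ (Fin N)) ht
      simp_rw [neg_mul] at this
      rw [integral_undef hc] at this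
      have h2 : 0 < (π / t) ^ ((Module.finrank ℝ (EuclideanSpace ℝ (Fin N)) : ℝ) / 2) := by positivity
      linarith
    refine J.bdd_mul (c := (∫ x, ‖fB N x‖) ^ 2) ?_ ?_
    · exact (fhat_cont.norm.pow 2).aestronglyMeasurable
    · filter_upwards with ξ
      rw [norm_pow, norm_norm]
      gcongr
      exact fhat_bdd ξ
  have i2 : Integrable fun h : EuclideanSpace ℝ (Fin N) => volume.real (lens h) * gK t h := by
    refine (gK_integrable ht).bdd_mul (c := volume.real (Metric.ball (0 : EuclideanSpace ℝ (Fin N)) 1)) ?_ ?_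
    · exact lens_meas.ennreal_toReal.aestronglyMeasurable
    · filter_upwards with h
      rw [Real.norm_of_nonneg measureReal_nonneg]
      exact ENNReal.toReal_mono measure_ball_lt_top.ne (lens_le h)
  have e2 : ∀ h : EuclideanSpace ℝ (Fin N), volume (lens h) * ENNReal.ofReal (gK t h)
      = ENNReal.ofReal (volume.real (lens h) * gK t h) := by
    intro h
    rw [ENNReal.ofReal_mul measureReal_nonneg, ofReal_measureReal (lens_ne_top h)]
  simp_rw [e2]
  rw [← ofReal_integral_eq_lintegral_ofReal i1 (Filter.Eventually.of_forall fun _ => by positivity),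
    ← ofReal_integral_eq_lintegral_ofReal i2
      (Filter.Eventually.of_forall fun _ => mul_nonneg measureReal_nonneg (gK_nonneg ht _)),
    gauss_identity_real ht]


lemma lens_contAt {N : ℕ} :
    ContinuousAt (fun h : EuclideanSpace ℝ (Fin N) => ((volume.real (lens h) : ℝ) : ℂ)) 0 := by
  have h0 : lens (0 : EuclideanSpace ℝ (Fin N)) = Metric.ball 0 1 := by
    ext x; simp [lens]
  apply Complex.continuous_ofReal.continuousAt.comp
  unfold ContinuousAt
  simp only [h0]
  have hlow : ∀ᶠ h : EuclideanSpace ℝ (Fin N) in nhds 0,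
      (1 - ‖h‖) ^ N * volume.real (Metric.ball (0 : EuclideanSpace ℝ (Fin N)) 1)
        ≤ volume.real (lens h) := by
    filter_upwards [Metric.ball_mem_nhds (0 : EuclideanSpace ℝ (Fin N)) one_pos] with h hh
    have hh : ‖h‖ < 1 := by simpa using hh
    have hsub : Metric.ball (0 : EuclideanSpace ℝ (Fin N)) (1 - ‖h‖) ⊆ lens h := by
      intro x hx
      have hx : ‖x‖ < 1 - ‖h‖ := by simpa using hx
      have := norm_nonneg h
      have := norm_sub_le h x
      exact ⟨by linarith, by linarith⟩
    have h1 := measureReal_mono (μ := volume) hsub (lens_ne_top h)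
    have h2 : volume.real (Metric.ball (0 : EuclideanSpace ℝ (Fin N)) (1 - ‖h‖))
        = (1 - ‖h‖) ^ N * volume.real (Metric.ball (0 : EuclideanSpace ℝ (Fin N)) 1) := by
      rw [Measure.real, Measure.addHaar_ball_of_pos _ _ (by linarith), ENNReal.toReal_mul,
        ENNReal.toReal_ofReal (by have : 0 < 1 - ‖h‖ := by linarith
                                  positivity), finrank_euclideanSpace, Fintype.card_fin]
      rfl
    linarith
  refine tendsto_of_tendsto_of_tendsto_of_le_of_le' ?_ tendsto_const_nhds hlow
    (Filter.Eventually.of_forall fun h => ENNReal.toReal_mono measure_ball_lt_top.ne (lens_le h))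
  have hc : Continuous fun h : EuclideanSpace ℝ (Fin N) =>
      (1 - ‖h‖) ^ N * volume.real (Metric.ball (0 : EuclideanSpace ℝ (Fin N)) 1) := by fun_prop
  have := hc.tendsto 0
  simpa using this

lemma lens_gK_tendsto {N : ℕ} :
    Filter.Tendsto (fun c : ℝ => ∫ h : EuclideanSpace ℝ (Fin N), volume.real (lens h) * gK (1 / c) h)
      Filter.atTop (nhds (volume.real (Metric.ball (0 : EuclideanSpace ℝ (Fin N)) 1))) := by
  have h := Real.tendsto_integral_gaussian_smul' (lens_integrable (N := N)) lens_contAt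
  have h0 : lens (0 : EuclideanSpace ℝ (Fin N)) = Metric.ball 0 1 := by
    ext x; simp [lens]
  rw [h0] at h
  have h2 := (Complex.continuous_re.tendsto _).comp h
  simp only [Complex.ofReal_re] at h2
  refine h2.congr' ?_
  filter_upwards [Filter.eventually_gt_atTop 0] with c hc
  simp only [Function.comp]
  rw [← Complex.ofReal_re (∫ h : EuclideanSpace ℝ (Fin N), volume.real (lens h) * gK (1 / c) h),
    ← integral_complex_ofReal]
  congr 2
  ext w
  rw [gK, finrank_euclideanSpace, Fintype.card_fin, smul_eq_mul, zero_sub, norm_neg]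
  push_cast
  rw [Complex.ofReal_cpow (by positivity)]
  push_cast
  rw [mul_comm]
  congr 2
  · congr 1
    field_simp
  · congr 1
    field_simp

lemma plancherel {N : ℕ} :
    ∫⁻ ξ : EuclideanSpace ℝ (Fin N), ENNReal.ofReal (‖𝓕 (fB N) ξ‖ ^ 2)
      = volume (Metric.ball (0 : EuclideanSpace ℝ (Fin N)) 1) := by
  have hmeas : ∀ t : ℝ, Measurable fun ξ : EuclideanSpace ℝ (Fin N) =>
      ENNReal.ofReal (‖𝓕 (fB N) ξ‖ ^ 2 * Real.exp (-(t * ‖ξ‖ ^ 2))) := by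
    intro t
    exact (((fhat_cont (N := N)).norm.pow 2).mul (by fun_prop)).measurable.ennreal_ofReal
  have ht : ∀ n : ℕ, (0:ℝ) < 1 / ((n:ℝ) + 1) := fun n => by positivity
  have A : Filter.Tendsto (fun n : ℕ => ∫⁻ ξ : EuclideanSpace ℝ (Fin N),
      ENNReal.ofReal (‖𝓕 (fB N) ξ‖ ^ 2 * Real.exp (-((1 / ((n:ℝ) + 1)) * ‖ξ‖ ^ 2)))) Filter.atTop
      (nhds (∫⁻ ξ : EuclideanSpace ℝ (Fin N), ENNReal.ofReal (‖𝓕 (fB N) ξ‖ ^ 2))) := by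
    refine lintegral_tendsto_of_tendsto_of_monotone (fun n => (hmeas _).aemeasurable) ?_ ?_
    · refine Filter.Eventually.of_forall fun ξ n m hnm => ?_
      apply ENNReal.ofReal_le_ofReal
      gcongr
    · refine Filter.Eventually.of_forall fun ξ => ?_
      apply (ENNReal.continuous_ofReal.tendsto _).comp
      have h1 := tendsto_one_div_add_atTop_nhds_zero_nat (𝕜 := ℝ)
      have hc : Continuous fun t : ℝ => ‖𝓕 (fB N) ξ‖ ^ 2 * Real.exp (-(t * ‖ξ‖ ^ 2)) := by fun_prop
      have := (hc.tendsto 0).comp h1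
      simpa [Function.comp_def] using this
  have B : Filter.Tendsto (fun n : ℕ => ∫⁻ ξ : EuclideanSpace ℝ (Fin N),
      ENNReal.ofReal (‖𝓕 (fB N) ξ‖ ^ 2 * Real.exp (-((1 / ((n:ℝ) + 1)) * ‖ξ‖ ^ 2)))) Filter.atTop
      (nhds (volume (Metric.ball (0 : EuclideanSpace ℝ (Fin N)) 1))) := by
    have hn : Filter.Tendsto (fun n : ℕ => (n:ℝ) + 1) Filter.atTop Filter.atTop :=
      Filter.tendsto_atTop_add_const_right _ _ tendsto_natCast_atTop_atTop
    have h1 := (ENNReal.continuous_ofReal.tendsto _).comp ((lens_gK_tendsto (N := N)).comp hn)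
    rw [ofReal_measureReal measure_ball_lt_top.ne] at h1
    refine h1.congr fun n => ?_
    simp only [Function.comp]
    rw [gauss_identity (ht n)]
    have i2 : Integrable fun h : EuclideanSpace ℝ (Fin N) =>
        volume.real (lens h) * gK (1 / ((n:ℝ) + 1)) h := by
      refine (gK_integrable (ht n)).bdd_mul
        (c := volume.real (Metric.ball (0 : EuclideanSpace ℝ (Fin N)) 1)) ?_ ?_
      · exact lens_meas.ennreal_toReal.aestronglyMeasurable
      · filter_upwards with h
        rw [Real.norm_of_nonneg measureReal_nonneg]
        exact ENNReal.toReal_mono measure_ball_lt_top.ne (lens_le h)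
    rw [ofReal_integral_eq_lintegral_ofReal i2
      (Filter.Eventually.of_forall fun _ => mul_nonneg measureReal_nonneg (gK_nonneg (ht n) _))]
    refine lintegral_congr fun h => ?_
    rw [ENNReal.ofReal_mul measureReal_nonneg, ofReal_measureReal (lens_ne_top h)]
  exact tendsto_nhds_unique A B

lemma slab_identity {N : ℕ} {t : ℝ} (ht : 0 < t) :
    ∫⁻ ξ : EuclideanSpace ℝ (Fin N), ENNReal.ofReal ((1 - Real.exp (-(t * ‖ξ‖ ^ 2))) * ‖𝓕 (fB N) ξ‖ ^ 2)
     = ∫⁻ h : EuclideanSpace ℝ (Fin N), volume (slab h) * ENNReal.ofReal (gK t h) := by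
  have hg : ∫⁻ h : EuclideanSpace ℝ (Fin N), ENNReal.ofReal (gK t h) = 1 := by
    rw [← ofReal_integral_eq_lintegral_ofReal (gK_integrable ht)
      (Filter.Eventually.of_forall fun h => gK_nonneg ht h), gK_integral ht, ENNReal.ofReal_one]
  have hgm : Measurable fun h : EuclideanSpace ℝ (Fin N) => ENNReal.ofReal (gK t h) :=
    (gK_cont t).measurable.ennreal_ofReal
  have s1 : (∫⁻ h : EuclideanSpace ℝ (Fin N), volume (lens h) * ENNReal.ofReal (gK t h))
      + ∫⁻ h : EuclideanSpace ℝ (Fin N), volume (slab h) * ENNReal.ofReal (gK t h)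
      = volume (Metric.ball (0 : EuclideanSpace ℝ (Fin N)) 1) := by
    have hm : Measurable fun h : EuclideanSpace ℝ (Fin N) => volume (lens h) * ENNReal.ofReal (gK t h) :=
      lens_meas.mul hgm
    rw [← lintegral_add_left hm]
    simp_rw [← add_mul, lens_add_slab]
    rw [lintegral_const_mul _ hgm, hg, mul_one]
  have hmeas : Measurable fun ξ : EuclideanSpace ℝ (Fin N) =>
      ENNReal.ofReal (‖𝓕 (fB N) ξ‖ ^ 2 * Real.exp (-(t * ‖ξ‖ ^ 2))) :=
    (((fhat_cont (N := N)).norm.pow 2).mul (by fun_prop)).measurable.ennreal_ofReal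
  have s2 : (∫⁻ ξ : EuclideanSpace ℝ (Fin N), ENNReal.ofReal (‖𝓕 (fB N) ξ‖ ^ 2 * Real.exp (-(t * ‖ξ‖ ^ 2))))
      + ∫⁻ ξ : EuclideanSpace ℝ (Fin N), ENNReal.ofReal ((1 - Real.exp (-(t * ‖ξ‖ ^ 2))) * ‖𝓕 (fB N) ξ‖ ^ 2)
      = volume (Metric.ball (0 : EuclideanSpace ℝ (Fin N)) 1) := by
    rw [← lintegral_add_left hmeas, ← plancherel]
    refine lintegral_congr fun ξ => ?_
    have : Real.exp (-(t * ‖ξ‖ ^ 2)) ≤ 1 := Real.exp_le_one_iff.2 (by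
      have : 0 ≤ t * ‖ξ‖ ^ 2 := by positivity
      linarith)
    rw [← ENNReal.ofReal_add (by positivity) (mul_nonneg (by linarith) (by positivity))]
    congr 1; ring
  rw [gauss_identity ht] at s2
  rw [← s1] at s2
  refine (ENNReal.add_right_inj ?_).1 s2
  refine ne_top_of_le_ne_top (measure_ball_lt_top (μ := volume)
    (x := (0 : EuclideanSpace ℝ (Fin N))) (r := 1)).ne ?_
  rw [← s1]; exact le_self_add

lemma main_chain {N : ℕ} {s : ℝ} (hs : 0 < s) (hs1 : s < 1) (hN : 0 < N) :
    ∫⁻ ξ : EuclideanSpace ℝ (Fin N), ENNReal.ofReal (‖ξ‖ ^ (2 * s) * ‖𝓕 (fB N) ξ‖ ^ 2)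
    = ENNReal.ofReal (s / Gamma (1 - s)) *
      ((∫⁻ h : EuclideanSpace ℝ (Fin N), volume (slab h) * ENNReal.ofReal (‖h‖ ^ (-((N:ℝ) + 2 * s))))
        * ENNReal.ofReal (π ^ ((N:ℝ) / 2) * π ^ (-((N:ℝ) + 2 * s)) * Gamma (s + N / 2))) := by
  have : Nonempty (Fin N) := ⟨⟨0, hN⟩⟩
  have hG : 0 < Gamma (1 - s) := Gamma_pos_of_pos (by linarith)
  have hfm : Measurable fun ξ : EuclideanSpace ℝ (Fin N) => ‖𝓕 (fB N) ξ‖ ^ 2 :=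
    ((fhat_cont (N := N)).norm.pow 2).measurable
  have h1 : ∀ ξ : EuclideanSpace ℝ (Fin N), ENNReal.ofReal (‖ξ‖ ^ (2 * s) * ‖𝓕 (fB N) ξ‖ ^ 2)
      = ENNReal.ofReal (s / Gamma (1 - s)) * ∫⁻ t in Set.Ioi (0:ℝ),
        ENNReal.ofReal (t ^ (-1 - s)) *
          ENNReal.ofReal ((1 - Real.exp (-(t * ‖ξ‖ ^ 2))) * ‖𝓕 (fB N) ξ‖ ^ 2) := by
    intro ξ
    have e1 : ∫⁻ t in Set.Ioi (0:ℝ), ENNReal.ofReal (t ^ (-1 - s)) *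
          ENNReal.ofReal ((1 - Real.exp (-(t * ‖ξ‖ ^ 2))) * ‖𝓕 (fB N) ξ‖ ^ 2)
        = ∫⁻ t in Set.Ioi (0:ℝ), ENNReal.ofReal (t ^ (-1 - s) * (1 - Real.exp (-(t * ‖ξ‖ ^ 2))))
          * ENNReal.ofReal (‖𝓕 (fB N) ξ‖ ^ 2) := by
      refine setLIntegral_congr_fun measurableSet_Ioi fun t ht => ?_
      have ht : 0 < t := ht
      have : Real.exp (-(t * ‖ξ‖ ^ 2)) ≤ 1 := Real.exp_le_one_iff.2 (by
        have : 0 ≤ t * ‖ξ‖ ^ 2 := by positivity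
        linarith)
      rw [← ENNReal.ofReal_mul (by positivity), ← ENNReal.ofReal_mul
        (mul_nonneg (by positivity) (by linarith)), mul_assoc]
    rw [e1, lintegral_mul_const _ (by fun_prop), aux_C hs hs1 (by positivity),
      ← ENNReal.ofReal_mul (by positivity), ← ENNReal.ofReal_mul (by positivity)]
    congr 1
    rw [← rpow_natCast ‖ξ‖ 2, ← rpow_mul (norm_nonneg _)]
    push_cast
    field_simp
  rw [lintegral_congr h1, lintegral_const_mul' _ _ ENNReal.ofReal_ne_top, lintegral_lintegral_swap]
  swap
  · apply Measurable.aemeasurable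
    have : Measurable fun p : EuclideanSpace ℝ (Fin N) × ℝ => ‖𝓕 (fB N) p.1‖ ^ 2 :=
      hfm.comp measurable_fst
    simp only [Function.uncurry_def]
    fun_prop
  congr 1
  have h2 : ∫⁻ t in Set.Ioi (0:ℝ), ∫⁻ ξ : EuclideanSpace ℝ (Fin N), ENNReal.ofReal (t ^ (-1 - s)) *
          ENNReal.ofReal ((1 - Real.exp (-(t * ‖ξ‖ ^ 2))) * ‖𝓕 (fB N) ξ‖ ^ 2)
      = ∫⁻ t in Set.Ioi (0:ℝ), ∫⁻ h : EuclideanSpace ℝ (Fin N), ENNReal.ofReal (t ^ (-1 - s)) *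
         (volume (slab h) * ENNReal.ofReal (gK t h)) := by
    refine setLIntegral_congr_fun measurableSet_Ioi fun t ht => ?_
    rw [lintegral_const_mul' _ _ ENNReal.ofReal_ne_top, slab_identity ht,
      lintegral_const_mul' _ _ ENNReal.ofReal_ne_top]
  have hsm := measurable_slab (N := N)
  rw [h2, lintegral_lintegral_swap]
  swap
  · apply Measurable.aemeasurable
    have : Measurable fun p : ℝ × EuclideanSpace ℝ (Fin N) => volume (slab p.2) :=
      hsm.comp measurable_snd
    simp only [Function.uncurry_def, gK]
    fun_prop
  rw [← lintegral_mul_const _ (by fun_prop)]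
  refine lintegral_congr_ae ?_
  have hne : ∀ᵐ h : EuclideanSpace ℝ (Fin N), h ≠ 0 := by
    rw [ae_iff]; simp
  filter_upwards [hne] with h hh
  have hh : 0 < ‖h‖ := norm_pos_iff.2 hh
  have e3 : ∫⁻ t in Set.Ioi (0:ℝ), ENNReal.ofReal (t ^ (-1 - s)) *
         (volume (slab h) * ENNReal.ofReal (gK t h))
      = ∫⁻ t in Set.Ioi (0:ℝ), volume (slab h) * ENNReal.ofReal (t ^ (-1 - s) *
        ((π / t) ^ ((N:ℝ) / 2) * Real.exp (-(π ^ 2 * ‖h‖ ^ 2) / t))) := by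
    refine setLIntegral_congr_fun measurableSet_Ioi fun t ht => ?_
    have ht : 0 < t := ht
    rw [mul_left_comm, ← ENNReal.ofReal_mul (by positivity), gK]
  rw [e3, lintegral_const_mul _ (by fun_prop), aux_D N hs (by positivity), mul_assoc,
    ← ENNReal.ofReal_mul (by positivity)]
  congr 2
  rw [← mul_pow, ← rpow_natCast, ← rpow_mul (by positivity), mul_rpow (by positivity) (by positivity)]
  have : (((2:ℕ):ℝ)) * -(s + (N:ℝ) / 2) = -((N:ℝ) + 2 * s) := by push_cast; ring
  rw [this]; ring

theorem integral_rpow_mul_sq_fourier_indicator_ball (N : ℕ) (hN : 2 ≤ N) (s : ℝ) (hs : 0 < s)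
    (hs' : s < 1 / 2) :
    ∫⁻ ξ : EuclideanSpace ℝ (Fin N),
        ENNReal.ofReal (‖ξ‖ ^ (2 * s)
          * ‖𝓕 ((Metric.ball (0 : EuclideanSpace ℝ (Fin N)) 1).indicator
              (fun _ => (1 : ℂ))) ξ‖ ^ 2)
    = ENNReal.ofReal
        ((2 * π ^ ((N : ℝ) / 2) / Gamma ((N : ℝ) / 2))
          * Gamma (1 - 2 * s) * Gamma (((N : ℝ) + 2 * s) / 2)
          / (2 * π ^ (2 * s) * Gamma (1 - s) ^ 2 * Gamma (((N : ℝ) + 2 - 2 * s) / 2))) := by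
  have hN0 : (0:ℝ) < N := by exact_mod_cast (by omega : 0 < N)
  have h := main_chain (N := N) hs (by linarith) (by omega)
  rw [aux_E ⟨0, by omega⟩ hs hs'] at h
  unfold fB at h
  rw [h]
  have : Nonempty (Fin N) := ⟨⟨0, by omega⟩⟩
  have g1 : 0 < Gamma (1 - s) := Gamma_pos_of_pos (by linarith)
  have g2 : 0 < Gamma (1 / 2 - s) := Gamma_pos_of_pos (by linarith)
  have g3 : 0 < Gamma ((N:ℝ) / 2) := Gamma_pos_of_pos (by positivity)
  have g4 : 0 < Gamma ((N:ℝ) / 2 + 1 - s) := Gamma_pos_of_pos (by linarith)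
  have g5 : 0 < Gamma (s + (N:ℝ) / 2) := Gamma_pos_of_pos (by positivity)
  have g6 : 0 < Gamma (1 - 2 * s) := Gamma_pos_of_pos (by linarith)
  have hsq : √π ^ N = π ^ ((N:ℝ) / 2) := by
    rw [sqrt_eq_rpow, ← rpow_natCast, ← rpow_mul pi_pos.le]; congr 1; ring
  have hv : (N : ℝ≥0∞) * volume (Metric.ball (0 : EuclideanSpace ℝ (Fin N)) 1)
      = ENNReal.ofReal (2 * π ^ ((N : ℝ) / 2) / Gamma ((N : ℝ) / 2)) := by
    rw [EuclideanSpace.volume_ball, Fintype.card_fin, ENNReal.ofReal_one, one_pow, one_mul,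
      ← ENNReal.ofReal_natCast, ← ENNReal.ofReal_mul (by positivity), hsq,
      Gamma_add_one (by positivity)]
    congr 1; field_simp
  rw [hv, ← ENNReal.ofReal_mul (by positivity), ← ENNReal.ofReal_mul (by positivity),
    ← ENNReal.ofReal_mul (by positivity), ← ENNReal.ofReal_mul (by positivity)]
  congr 1
  have dup := Real.Gamma_mul_Gamma_add_half (1 / 2 - s)
  rw [show 1 / 2 - s + 1 / 2 = 1 - s by ring, show 2 * (1 / 2 - s) = 1 - 2 * s by ring,
    show 1 - (1 - 2 * s) = 2 * s by ring] at dup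
  have dup' : Gamma (1 / 2 - s) = Gamma (1 - 2 * s) * 2 ^ (2 * s) * √π / Gamma (1 - s) := by
    rw [eq_div_iff g1.ne']; exact dup
  rw [dup', show ((N:ℝ) + 2 * s) / 2 = s + N / 2 by ring,
    show ((N:ℝ) + 2 - 2 * s) / 2 = N / 2 + 1 - s by ring]
  have p2 : (2:ℝ) ^ (-2 * s) = ((2:ℝ) ^ (2 * s))⁻¹ := by
    rw [neg_mul, rpow_neg (by norm_num)]
  have hpi : √π * π ^ (((N:ℝ) - 1) / 2) * (π ^ ((N:ℝ) / 2) * π ^ (-((N:ℝ) + 2 * s)))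
      = (π ^ (2 * s))⁻¹ := by
    rw [sqrt_eq_rpow, ← rpow_neg pi_pos.le, ← rpow_add pi_pos, ← rpow_add pi_pos,
      ← rpow_add pi_pos]
    congr 1; ring
  have p3 : (0:ℝ) < 2 ^ (2 * s) := by positivity
  have p4 : (0:ℝ) < π ^ (2 * s) := by positivity
  rw [p2]
  have key : ∀ A V a b c d e f g x p q r w : ℝ, 0 < a → 0 < d → 0 < x → 0 < s → 0 < w →
      p * q * (r * e) = w⁻¹ →
      s / a * (V * (x⁻¹ / (2 * s) * (b * x * p / a * q / d)) * (r * e * f))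
       = V * b * f / (2 * w * a ^ 2 * d) := by
    intro A V a b c d e f g x p q r w ha hd hx hs hw hh
    have : s / a * (V * (x⁻¹ / (2 * s) * (b * x * p / a * q / d)) * (r * e * f))
       = V * b * f / (2 * a ^ 2 * d) * (p * q * (r * e)) := by field_simp
    rw [this, hh]; field_simp
  exact key 0 _ _ _ 0 _ _ _ 0 _ _ _ _ _ g1 g4 p3 hs p4 hpi
end

section
/- Let N ≥ 2 and 0 < s < 1/2. Then the Frank–Seiringer constant admits the explicit evaluation: 2 σ_{N-2} ∫_0^1 r^(2s-1) (1 - r^(N-2s)) ( ∫_{-1}^1 (1-t²)^((N-3)/2) / (1 - 2rt + r²)^((N+2s)/2) dt ) dr = (N-2s) · π^(N/2) · Γ(1-2s) / ( s · Γ(1-s) · Γ((N+2-2s)/2) ), where σ_{N-2} = 2π^((N-1)/2)/Γ((N-1)/2). -/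
open MeasureTheory Real
open scoped ENNReal

namespace FSaux
open Set Filter Topology

lemma ftc_nonneg {f f' : ℝ → ℝ} {fa fb : ℝ}
    (hderiv : ∀ x ∈ Ioo (0:ℝ) 1, HasDerivAt f (f' x) x) (hpos : ∀ x ∈ Ioo (0:ℝ) 1, 0 ≤ f' x)
    (ha : Tendsto f (𝓝[>] 0) (𝓝 fa)) (hb : Tendsto f (𝓝[<] 1) (𝓝 fb)) :
    ∫ y in Ioo (0:ℝ) 1, f' y = fb - fa := by
  have hcont : ContinuousOn f (Ioo 0 1) := fun x hx => (hderiv x hx).continuousAt.continuousWithinAt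
  have hc := continuousOn_Icc_extendFrom_Ioo hcont ha hb
  have hd : ∀ x ∈ Ioo (0:ℝ) 1, HasDerivAt (extendFrom (Ioo 0 1) f) (f' x) x := by
    intro x hx
    refine (hderiv x hx).congr_of_eventuallyEq ?_
    filter_upwards [Ioo_mem_nhds hx.1 hx.2] with y hy
    exact extendFrom_eq (subset_closure hy) (hcont y hy)
  have hint : IntervalIntegrable f' volume 0 1 := by
    rw [intervalIntegrable_iff_integrableOn_Ioc_of_le zero_le_one]
    exact intervalIntegral.integrableOn_deriv_of_nonneg hc hd hpos
  rw [← intervalIntegral.integral_eq_sub_of_hasDerivAt_of_tendsto zero_lt_one hderiv hint ha hb,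
    intervalIntegral.integral_of_le zero_le_one, integral_Ioc_eq_integral_Ioo]

lemma beta_val {α β : ℝ} (hα : 0 < α) (hβ : 0 < β) :
    ∫ t in Ioo (-1:ℝ) 1, (1 - t) ^ (α - 1) * (1 + t) ^ (β - 1)
      = 2 ^ (α + β - 1) * (Gamma α * Gamma β / Gamma (α + β)) := by
  have h := Complex.betaIntegral_scaled (β : ℂ) (α : ℂ) (a := 2) two_pos
  have h2 : ∫ x in (0:ℝ)..2, (x : ℂ) ^ ((β:ℂ) - 1) * (((2:ℝ) : ℂ) - x) ^ ((α:ℂ) - 1)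
      = ((∫ x in (0:ℝ)..2, x ^ (β - 1) * (2 - x) ^ (α - 1) : ℝ) : ℂ) := by
    rw [← intervalIntegral.integral_ofReal]
    refine intervalIntegral.integral_congr fun x hx => ?_
    rw [uIcc_of_le (by norm_num)] at hx
    rw [Complex.ofReal_mul, Complex.ofReal_cpow hx.1, Complex.ofReal_cpow (by linarith [hx.2])]
    push_cast; rfl
  rw [h2, Complex.betaIntegral_eq_Gamma_mul_div _ _ (by simpa) (by simpa), ← Complex.ofReal_add,
    Complex.Gamma_ofReal, Complex.Gamma_ofReal, Complex.Gamma_ofReal] at h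
  have h3 : ∫ x in (0:ℝ)..2, x ^ (β - 1) * (2 - x) ^ (α - 1)
      = 2 ^ (α + β - 1) * (Gamma α * Gamma β / Gamma (α + β)) := by
    apply Complex.ofReal_injective
    rw [h]
    rw [show ((β + α : ℝ) : ℂ) - 1 = ((α + β - 1 : ℝ) : ℂ) by push_cast; ring,
      ← Complex.ofReal_cpow (by norm_num)]
    push_cast
    rw [add_comm β α]
    ring
  rw [← h3, ← integral_Ioc_eq_integral_Ioo, ← intervalIntegral.integral_of_le (by norm_num)]
  have := intervalIntegral.integral_comp_add_right (a := -1) (b := 1)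
    (fun x : ℝ => x ^ (β - 1) * (2 - x) ^ (α - 1)) 1
  norm_num at this
  rw [← this]
  refine intervalIntegral.integral_congr fun x hx => ?_
  rw [mul_comm]; congr 2 <;> ring

lemma beta_int {α β : ℝ} (hα : 0 < α) (hβ : 0 < β) :
    IntegrableOn (fun t : ℝ => (1 - t) ^ (α - 1) * (1 + t) ^ (β - 1)) (Ioo (-1) 1) := by
  by_contra h
  have h1 := beta_val hα hβ
  rw [integral_undef h] at h1
  have := Gamma_pos_of_pos hα
  have := Gamma_pos_of_pos hβ
  have := Gamma_pos_of_pos (add_pos hα hβ)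
  have : (0:ℝ) < 2 ^ (α + β - 1) * (Gamma α * Gamma β / Gamma (α + β)) := by positivity
  linarith

lemma v_int {n : ℝ} (hn : 2 ≤ n) :
    IntegrableOn (fun t : ℝ => (1 - t ^ 2) ^ ((n - 3) / 2)) (Ioo (-1) 1) := by
  have h := beta_int (α := (n - 1) / 2) (β := (n - 1) / 2) (by linarith) (by linarith)
  refine h.congr_fun (fun t ht => ?_) measurableSet_Ioo
  simp only
  rw [← Real.mul_rpow (by linarith [ht.2]) (by linarith [ht.1])]
  congr 1 <;> ring

lemma Q_pos {r t : ℝ} (h0 : 0 < r) (h1 : r < 1) (ht : t ∈ Icc (-1:ℝ) 1) :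
    0 < 1 - 2 * r * t + r ^ 2 := by
  have : 0 ≤ r * (1 - t) := mul_nonneg h0.le (by linarith [ht.2])
  nlinarith [sq_pos_of_pos (sub_pos.2 h1)]

lemma vc_int {n : ℝ} (hn : 2 ≤ n) {g : ℝ → ℝ} (hg : ContinuousOn g (Icc (-1) 1)) :
    IntegrableOn (fun t : ℝ => (1 - t ^ 2) ^ ((n - 3) / 2) * g t) (Ioo (-1) 1) := by
  obtain ⟨C, hC⟩ := isCompact_Icc.exists_bound_of_continuousOn hg
  refine Integrable.mul_bdd (c := C) (v_int hn)
    ((hg.mono Ioo_subset_Icc_self).aestronglyMeasurable measurableSet_Ioo) ?_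
  filter_upwards [ae_restrict_mem measurableSet_Ioo] with t ht
  exact hC t (Ioo_subset_Icc_self ht)

/-- the exact `t`-derivative integrates to zero -/
lemma exact_zero {n b r : ℝ} (hn : 2 ≤ n) (h0 : 0 < r) (h1 : r < 1) :
    ∫ t in Ioo (-1:ℝ) 1, (1 - t ^ 2) ^ ((n - 3) / 2) *
      ((-(n - 1) * t * (1 - 2 * r * t + r ^ 2) + 2 * b * r * (1 - t ^ 2)) *
        (1 - 2 * r * t + r ^ 2) ^ (-b - 1)) = 0 := by
  rw [← integral_Ioc_eq_integral_Ioo, ← intervalIntegral.integral_of_le (by norm_num)]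
  rw [intervalIntegral.integral_eq_sub_of_hasDerivAt_of_le
    (f := fun t => (1 - t ^ 2) ^ ((n - 1) / 2) * (1 - 2 * r * t + r ^ 2) ^ (-b)) (by norm_num)]
  · have : (n - 1) / 2 ≠ 0 := by linarith
    simp [Real.zero_rpow this]
  · refine ContinuousOn.mul ?_ ?_
    · exact (ContinuousOn.rpow_const (by fun_prop) fun x _ => Or.inr (by linarith))
    · exact (ContinuousOn.rpow_const (by fun_prop) fun x hx => Or.inl (Q_pos h0 h1 hx).ne')
  · intro t ht
    have hq := Q_pos h0 h1 (Ioo_subset_Icc_self ht)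
    have hv : 0 < 1 - t ^ 2 := by nlinarith [ht.1, ht.2]
    have d1 : HasDerivAt (fun t : ℝ => 1 - t ^ 2) (-(2 * t)) t := by
      simpa using ((hasDerivAt_id t).pow 2).const_sub 1
    have d2 : HasDerivAt (fun t : ℝ => 1 - 2 * r * t + r ^ 2) (-(2 * r)) t := by
      simpa using (((hasDerivAt_id t).const_mul (2 * r)).const_sub 1).add_const (r ^ 2)
    have := (d1.rpow_const (p := (n - 1) / 2) (Or.inl hv.ne')).mul
      (d2.rpow_const (p := -b) (Or.inl hq.ne'))
    refine this.congr_deriv ?_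
    rw [show (n - 1) / 2 - 1 = (n - 3) / 2 by ring,
      show (n - 1) / 2 = (n - 3) / 2 + 1 by ring, Real.rpow_add_one hv.ne',
      show (1 - 2 * r * t + r ^ 2) ^ (-b) = (1 - 2 * r * t + r ^ 2) ^ (-b - 1 + 1) by congr 1; ring,
      Real.rpow_add_one hq.ne']
    ring
  · rw [intervalIntegrable_iff_integrableOn_Ioo_of_le (by norm_num)]
    refine vc_int hn (ContinuousOn.mul (by fun_prop) ?_)
    exact (ContinuousOn.rpow_const (by fun_prop) fun x hx => Or.inl (Q_pos h0 h1 hx).ne')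

noncomputable def P (n s r t : ℝ) : ℝ := (r ^ (2 * s) * (1 - r * t) + r ^ (n - 1) * (r - t)) *
  (1 - 2 * r * t + r ^ 2) ^ (-((n + 2 * s) / 2))

noncomputable def dP (n s r t : ℝ) : ℝ :=
  2 * s * (r ^ (2 * s - 1) - r ^ (n - 1)) * (1 - 2 * r * t + r ^ 2) ^ (-((n + 2 * s) / 2)) +
  (r ^ (n - 2) - r ^ (2 * s)) *
    ((-(n - 1) * t * (1 - 2 * r * t + r ^ 2) + 2 * ((n + 2 * s) / 2) * r * (1 - t ^ 2)) *
        (1 - 2 * r * t + r ^ 2) ^ (-((n + 2 * s) / 2) - 1))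

lemma P_deriv {n s r t : ℝ} (h0 : 0 < r) (h1 : r < 1) (ht : t ∈ Icc (-1:ℝ) 1) :
    HasDerivAt (fun r => P n s r t) (dP n s r t) r := by
  have hq := Q_pos h0 h1 ht
  have d2 : HasDerivAt (fun r : ℝ => 1 - 2 * r * t + r ^ 2) (-(2 * t) + 2 * r) r := by
    have h1 : HasDerivAt (fun r : ℝ => 1 - 2 * r * t) (-(2 * t)) r := by
      simpa using (((hasDerivAt_id r).const_mul 2).mul_const t).const_sub 1
    have h2 : HasDerivAt (fun r : ℝ => r ^ 2) (2 * r) r := by simpa using hasDerivAt_pow 2 r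
    exact h1.add h2
  have d3 : HasDerivAt (fun r : ℝ => 1 - r * t) (-t) r := by
    simpa using ((hasDerivAt_id r).mul_const t).const_sub 1
  have d4 : HasDerivAt (fun r : ℝ => r - t) 1 r := (hasDerivAt_id r).sub_const t
  have d5 := Real.hasDerivAt_rpow_const (x := r) (p := 2 * s) (Or.inl h0.ne')
  have d6 := Real.hasDerivAt_rpow_const (x := r) (p := n - 1) (Or.inl h0.ne')
  have := ((d5.mul d3).add (d6.mul d4)).mul (d2.rpow_const (p := -((n + 2 * s) / 2)) (Or.inl hq.ne'))
  refine this.congr_deriv ?_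
  unfold dP
  rw [show n - 1 - 1 = n - 2 by ring]
  simp only [Pi.add_apply, Pi.mul_apply]
  have e1 : r ^ (2 * s) = r ^ (2 * s - 1) * r := by
    rw [← Real.rpow_add_one h0.ne']; congr 1; ring
  have e2 : r ^ (n - 1) = r ^ (n - 2) * r := by
    rw [← Real.rpow_add_one h0.ne']; congr 1; ring
  have e3 : (1 - 2 * r * t + r ^ 2) ^ (-((n + 2 * s) / 2)) =
    (1 - 2 * r * t + r ^ 2) ^ (-((n + 2 * s) / 2) - 1) * (1 - 2 * r * t + r ^ 2) := by
    rw [← Real.rpow_add_one hq.ne']; congr 1; ring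
  rw [e1, e2, e3]
  ring

lemma P_cont {n s r : ℝ} (h0 : 0 < r) (h1 : r < 1) :
    ContinuousOn (fun t => P n s r t) (Icc (-1) 1) := by
  unfold P
  refine ContinuousOn.mul (by fun_prop) ?_
  exact (ContinuousOn.rpow_const (by fun_prop) fun x hx => Or.inl (Q_pos h0 h1 hx).ne')

lemma dP_cont {n s : ℝ} :
    ContinuousOn (fun p : ℝ × ℝ => dP n s p.1 p.2) (Ioo 0 1 ×ˢ Icc (-1) 1) := by
  unfold dP
  have hQ : ∀ c : ℝ, ContinuousOn (fun p : ℝ × ℝ => (1 - 2 * p.1 * p.2 + p.1 ^ 2) ^ c)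
      (Ioo 0 1 ×ˢ Icc (-1) 1) := fun c =>
    ContinuousOn.rpow_const (by fun_prop) fun x hx => Or.inl (Q_pos hx.1.1 hx.1.2 hx.2).ne'
  have hr : ∀ c : ℝ, ContinuousOn (fun p : ℝ × ℝ => p.1 ^ c)
      (Ioo 0 1 ×ˢ Icc (-1) 1) := fun c =>
    ContinuousOn.rpow_const (by fun_prop) fun x hx => Or.inl hx.1.1.ne'
  refine ContinuousOn.add (ContinuousOn.mul (continuousOn_const.mul ((hr _).sub (hr _))) (hQ _))
    (ContinuousOn.mul ((hr _).sub (hr _)) (ContinuousOn.mul (by fun_prop) (hQ _)))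

noncomputable def Phi (n s r : ℝ) : ℝ := ∫ t in Ioo (-1:ℝ) 1, (1 - t ^ 2) ^ ((n - 3) / 2) * P n s r t

lemma Phi_deriv {n s r : ℝ} (hn : 2 ≤ n) (hr : r ∈ Ioo (0:ℝ) 1) :
    HasDerivAt (Phi n s) (2 * s * (r ^ (2 * s - 1) * (1 - r ^ (n - 2 * s)) *
      ∫ t in Ioo (-1:ℝ) 1, (1 - t ^ 2) ^ ((n - 3) / 2) /
        (1 - 2 * r * t + r ^ 2) ^ ((n + 2 * s) / 2))) r := by
  obtain ⟨h0, h1⟩ := hr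
  have hsub : Icc (r / 2) ((r + 1) / 2) ⊆ Ioo (0:ℝ) 1 := fun x hx =>
    ⟨by linarith [hx.1], by linarith [hx.2]⟩
  obtain ⟨C, hC⟩ := (isCompact_Icc (a := r / 2) (b := (r + 1) / 2) |>.prod
    (isCompact_Icc (a := (-1:ℝ)) (b := 1))).exists_bound_of_continuousOn
    ((dP_cont (n := n) (s := s)).mono (prod_mono hsub subset_rfl))
  have hs : Icc (r / 2) ((r + 1) / 2) ∈ 𝓝 r := Icc_mem_nhds (by linarith) (by linarith)
  have hdPr : ContinuousOn (fun t => dP n s r t) (Icc (-1) 1) :=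
    (dP_cont (n := n) (s := s)).comp (f := fun t => (r, t)) (by fun_prop) (fun t ht => ⟨⟨h0, h1⟩, ht⟩)
  have key := hasDerivAt_integral_of_dominated_loc_of_deriv_le (𝕜 := ℝ)
    (μ := volume.restrict (Ioo (-1:ℝ) 1)) (x₀ := r)
    (F := fun r t => (1 - t ^ 2) ^ ((n - 3) / 2) * P n s r t)
    (F' := fun r t => (1 - t ^ 2) ^ ((n - 3) / 2) * dP n s r t)
    (bound := fun t => (1 - t ^ 2) ^ ((n - 3) / 2) * C) hs
    (by
      filter_upwards [hs] with x hx
      exact (vc_int hn (P_cont (hsub hx).1 (hsub hx).2)).aestronglyMeasurable)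
    (vc_int hn (P_cont h0 h1))
    (vc_int hn hdPr).aestronglyMeasurable
    (by
      filter_upwards [ae_restrict_mem measurableSet_Ioo] with t ht x hx
      have hv : 0 < 1 - t ^ 2 := by nlinarith [ht.1, ht.2]
      rw [norm_mul, Real.norm_of_nonneg (Real.rpow_nonneg hv.le _)]
      exact mul_le_mul_of_nonneg_left (hC (x, t) ⟨hx, Ioo_subset_Icc_self ht⟩)
        (Real.rpow_nonneg hv.le _))
    ((v_int hn).mul_const C)
    (by
      filter_upwards [ae_restrict_mem measurableSet_Ioo] with t ht x hx
      exact (P_deriv (hsub hx).1 (hsub hx).2 (Ioo_subset_Icc_self ht)).const_mul _)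
  refine key.2.congr_deriv ?_
  have hqc : ∀ c : ℝ, ContinuousOn (fun t : ℝ => (1 - 2 * r * t + r ^ 2) ^ c) (Icc (-1) 1) :=
    fun c => ContinuousOn.rpow_const (by fun_prop) fun x hx => Or.inl (Q_pos h0 h1 hx).ne'
  have i1 := (vc_int hn (hqc (-((n + 2 * s) / 2)))).const_mul
    (2 * s * (r ^ (2 * s - 1) - r ^ (n - 1)))
  have i2 := (vc_int hn (g := fun t => ((-(n - 1) * t * (1 - 2 * r * t + r ^ 2) +
    2 * ((n + 2 * s) / 2) * r * (1 - t ^ 2)) *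
        (1 - 2 * r * t + r ^ 2) ^ (-((n + 2 * s) / 2) - 1)))
        (ContinuousOn.mul (by fun_prop) (hqc _))).const_mul (r ^ (n - 2) - r ^ (2 * s))
  have e : ∀ t, (1 - t ^ 2) ^ ((n - 3) / 2) * dP n s r t =
      2 * s * (r ^ (2 * s - 1) - r ^ (n - 1)) *
        ((1 - t ^ 2) ^ ((n - 3) / 2) * (1 - 2 * r * t + r ^ 2) ^ (-((n + 2 * s) / 2))) +
      (r ^ (n - 2) - r ^ (2 * s)) * ((1 - t ^ 2) ^ ((n - 3) / 2) *
        ((-(n - 1) * t * (1 - 2 * r * t + r ^ 2) +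
    2 * ((n + 2 * s) / 2) * r * (1 - t ^ 2)) *
        (1 - 2 * r * t + r ^ 2) ^ (-((n + 2 * s) / 2) - 1))) := by
    intro t; unfold dP; ring
  simp_rw [e]
  rw [integral_add i1 i2, integral_const_mul, integral_const_mul, exact_zero hn h0 h1, mul_zero,
    add_zero]
  have e2 : r ^ (n - 1) = r ^ (2 * s - 1) * r ^ (n - 2 * s) := by
    rw [← Real.rpow_add h0]; congr 1; ring
  rw [e2]
  have e3 : ∫ t in Ioo (-1:ℝ) 1, (1 - t ^ 2) ^ ((n - 3) / 2) *
        (1 - 2 * r * t + r ^ 2) ^ (-((n + 2 * s) / 2)) =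
      ∫ t in Ioo (-1:ℝ) 1, (1 - t ^ 2) ^ ((n - 3) / 2) /
        (1 - 2 * r * t + r ^ 2) ^ ((n + 2 * s) / 2) := by
    refine setIntegral_congr_fun measurableSet_Ioo fun t ht => ?_
    rw [Real.rpow_neg (Q_pos h0 h1 (Ioo_subset_Icc_self ht)).le, ← div_eq_mul_inv]
  rw [e3]; ring

lemma Phi_zero {n s : ℝ} (hn : 2 ≤ n) (hs : 0 < s) : Tendsto (Phi n s) (𝓝[>] 0) (𝓝 0) := by
  have : (0:ℝ) = ∫ t in Ioo (-1:ℝ) 1, (1 - t ^ 2) ^ ((n - 3) / 2) * (0 : ℝ) := by simp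
  suffices h : Tendsto (Phi n s) (𝓝[>] 0)
      (𝓝 (∫ t in Ioo (-1:ℝ) 1, (1 - t ^ 2) ^ ((n - 3) / 2) * (0 : ℝ))) by rwa [← this] at h
  have hb : 0 ≤ (n + 2 * s) / 2 := by linarith
  refine tendsto_integral_filter_of_dominated_convergence
    (fun t => (1 - t ^ 2) ^ ((n - 3) / 2) * (4 * (1 / 4 : ℝ) ^ (-((n + 2 * s) / 2)))) ?_ ?_
    ((v_int hn).mul_const _) ?_
  · filter_upwards [Ioo_mem_nhdsGT (show (0:ℝ) < 1 by norm_num)] with r hr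
    exact (vc_int hn (P_cont hr.1 hr.2)).aestronglyMeasurable
  · filter_upwards [Ioo_mem_nhdsGT (show (0:ℝ) < 1 / 2 by norm_num)] with r hr
    filter_upwards [ae_restrict_mem measurableSet_Ioo] with t ht
    obtain ⟨h0, h1⟩ := hr
    have hv : 0 < 1 - t ^ 2 := by nlinarith [ht.1, ht.2]
    have hq : 1 / 4 ≤ 1 - 2 * r * t + r ^ 2 := by nlinarith [mul_pos h0 (sub_pos.2 ht.2)]
    have a1 := Real.rpow_nonneg h0.le (2 * s)
    have a2 := Real.rpow_le_one h0.le (by linarith : r ≤ 1) (by linarith : 0 ≤ 2 * s)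
    have a3 := Real.rpow_nonneg h0.le (n - 1)
    have a4 := Real.rpow_le_one h0.le (by linarith : r ≤ 1) (by linarith : 0 ≤ n - 1)
    rw [norm_mul, Real.norm_of_nonneg (Real.rpow_nonneg hv.le _)]
    refine mul_le_mul_of_nonneg_left ?_ (Real.rpow_nonneg hv.le _)
    unfold P
    rw [norm_mul]
    gcongr
    · refine (norm_add_le _ _).trans ?_
      rw [norm_mul, norm_mul, Real.norm_of_nonneg a1, Real.norm_of_nonneg a3]
      have b1 : ‖1 - r * t‖ ≤ 2 := by
        rw [Real.norm_eq_abs, abs_le]; constructor <;> nlinarith [ht.1, ht.2]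
      have b2 : ‖r - t‖ ≤ 2 := by
        rw [Real.norm_eq_abs, abs_le]; constructor <;> nlinarith [ht.1, ht.2]
      nlinarith [norm_nonneg (1 - r * t), norm_nonneg (r - t)]
    · rw [Real.norm_of_nonneg (Real.rpow_nonneg (by linarith) _)]
      exact Real.rpow_le_rpow_of_nonpos (by norm_num) hq (by linarith)
  · filter_upwards with t
    refine Tendsto.const_mul _ ?_
    have : ContinuousAt (fun r => P n s r t) 0 := by
      unfold P
      refine ContinuousAt.mul (ContinuousAt.add (ContinuousAt.mul ?_ (by fun_prop))
        (ContinuousAt.mul ?_ (by fun_prop))) ?_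
      · exact continuousAt_id.rpow_const (Or.inr (by linarith))
      · exact continuousAt_id.rpow_const (Or.inr (by linarith))
      · exact ContinuousAt.rpow_const (by fun_prop) (Or.inl (by norm_num))
    have h := this.tendsto
    have e : P n s 0 t = 0 := by
      unfold P
      rw [Real.zero_rpow (by linarith), Real.zero_rpow (by linarith)]; simp
    rw [e] at h
    exact h.mono_left nhdsWithin_le_nhds

lemma Phi_one {n s : ℝ} (hn : 2 ≤ n) (hs : 0 < s) (hs' : s < 1 / 2) :
    Tendsto (Phi n s) (𝓝[<] 1)
      (𝓝 (2 ^ (-(2 * s)) * (Gamma (1 / 2 - s) * Gamma ((n - 1) / 2) / Gamma (n / 2 - s)))) := by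
  have hB := beta_int (α := 1 / 2 - s) (β := (n - 1) / 2) (by linarith) (by linarith)
  have hV := beta_val (α := 1 / 2 - s) (β := (n - 1) / 2) (by linarith) (by linarith)
  have ev : ∀ t ∈ Ioo (-1:ℝ) 1, (1 - t ^ 2) ^ ((n - 3) / 2) * (1 - t) ^ (1 - (n + 2 * s) / 2) =
      (1 - t) ^ (1 / 2 - s - 1) * (1 + t) ^ ((n - 1) / 2 - 1) := by
    intro t ht
    have p1 : 0 < 1 - t := by linarith [ht.2]
    have p2 : 0 < 1 + t := by linarith [ht.1]
    rw [show 1 - t ^ 2 = (1 - t) * (1 + t) by ring, Real.mul_rpow p1.le p2.le,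
      mul_right_comm, ← Real.rpow_add p1]
    congr 2 <;> ring
  have e1 : 2 ^ (-(2 * s)) * (Gamma (1 / 2 - s) * Gamma ((n - 1) / 2) / Gamma (n / 2 - s)) =
      ∫ t in Ioo (-1:ℝ) 1, (1 - t ^ 2) ^ ((n - 3) / 2) * P n s 1 t := by
    have : ∀ t ∈ Ioo (-1:ℝ) 1, (1 - t ^ 2) ^ ((n - 3) / 2) * P n s 1 t =
        2 ^ (1 - (n + 2 * s) / 2) * ((1 - t) ^ (1 / 2 - s - 1) * (1 + t) ^ ((n - 1) / 2 - 1)) := by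
      intro t ht
      have p1 : 0 < 1 - t := by linarith [ht.2]
      rw [← ev t ht]
      unfold P
      rw [Real.one_rpow, Real.one_rpow]
      rw [show 1 * (1 - 1 * t) + 1 * (1 - t) = 2 * (1 - t) by ring,
        show 1 - 2 * 1 * t + 1 ^ 2 = 2 * (1 - t) by ring,
        show 2 * (1 - t) * (2 * (1 - t)) ^ (-((n + 2 * s) / 2)) =
          (2 * (1 - t)) ^ (1 - (n + 2 * s) / 2) by
          rw [sub_eq_add_neg 1 ((n + 2 * s) / 2), Real.rpow_add (by positivity), Real.rpow_one],
        Real.mul_rpow two_pos.le p1.le]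
      ring
    rw [setIntegral_congr_fun measurableSet_Ioo this, integral_const_mul, hV, ← mul_assoc,
      ← Real.rpow_add two_pos]
    congr 2 
    · ring
    · congr 1; ring
  rw [e1]
  refine tendsto_integral_filter_of_dominated_convergence
    (fun t => (1 + n) * ((1 - t) ^ (1 / 2 - s - 1) * (1 + t) ^ ((n - 1) / 2 - 1))) ?_ ?_
    (hB.const_mul _) ?_
  · filter_upwards [Ioo_mem_nhdsLT (show (0:ℝ) < 1 by norm_num)] with r hr
    exact (vc_int hn (P_cont hr.1 hr.2)).aestronglyMeasurable
  · filter_upwards [Ioo_mem_nhdsLT (show (1/2:ℝ) < 1 by norm_num)] with r hr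
    filter_upwards [ae_restrict_mem measurableSet_Ioo] with t ht
    obtain ⟨hh, h1⟩ := hr
    have h0 : 0 < r := by linarith
    have hv : 0 < 1 - t ^ 2 := by nlinarith [ht.1, ht.2]
    have p1 : 0 < 1 - t := by linarith [ht.2]
    have hq := Q_pos h0 h1 (Ioo_subset_Icc_self ht)
    rw [← ev t ht, norm_mul, Real.norm_of_nonneg (Real.rpow_nonneg hv.le _), mul_left_comm]
    refine mul_le_mul_of_nonneg_left ?_ (Real.rpow_nonneg hv.le _)
    have q1 : 1 - t ≤ 1 - 2 * r * t + r ^ 2 := by nlinarith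
    have q2 : (1 - r) ^ 2 ≤ 1 - 2 * r * t + r ^ 2 := by nlinarith
    have a2 := Real.rpow_le_one h0.le h1.le (by linarith : 0 ≤ 2 * s)
    have a4 := Real.rpow_le_one h0.le h1.le (by linarith : 0 ≤ n - 2)
    have a1 := Real.rpow_nonneg h0.le (2 * s)
    have a3 := Real.rpow_nonneg h0.le (n - 2)
    have a5 : r ≤ r ^ (2 * s) := by
      simpa using Real.rpow_le_rpow_of_exponent_ge h0 h1.le (by linarith : 2 * s ≤ 1)
    have a6 : 1 - n * (1 - r) ≤ r ^ (n - 2) := by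
      have b1 := Real.rpow_le_rpow_of_exponent_ge h0 h1.le (by linarith : n - 2 ≤ n)
      have b2 := one_add_mul_self_le_rpow_one_add (s := r - 1) (by linarith) (by linarith : 1 ≤ n)
      rw [show 1 + (r - 1) = r by ring] at b2
      linarith
    have hlast : (1 - 2 * r * t + r ^ 2) ^ (1 - (n + 2 * s) / 2) ≤
        (1 - t) ^ (1 - (n + 2 * s) / 2) :=
      Real.rpow_le_rpow_of_nonpos p1 q1 (by linarith)
    refine le_trans ?_ (mul_le_mul_of_nonneg_left hlast (by linarith))
    rw [sub_eq_add_neg 1 ((n + 2 * s) / 2), Real.rpow_add hq, Real.rpow_one, ← mul_assoc]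
    unfold P
    rw [norm_mul, Real.norm_of_nonneg (Real.rpow_nonneg hq.le (-((n + 2 * s) / 2)))]
    refine mul_le_mul_of_nonneg_right ?_ (Real.rpow_nonneg hq.le _)
    have e2 : r ^ (n - 1) = r ^ (n - 2) * r := by
      rw [← Real.rpow_add_one h0.ne']; congr 1; ring
    have e3 : r ^ (2 * s) * (1 - r * t) + r ^ (n - 1) * (r - t) =
      (r ^ (2 * s) + r ^ (n - 2)) / 2 * (1 - 2 * r * t + r ^ 2) +
      (r ^ (2 * s) - r ^ (n - 2)) * ((1 - r ^ 2) / 2) := by rw [e2]; ring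
    rw [e3]
    generalize r ^ (2 * s) = x at *
    generalize r ^ (n - 2) = y at *
    have c1 : |x - y| ≤ n * (1 - r) := by rw [abs_le]; constructor <;> nlinarith
    have c2 : (x + y) / 2 * (1 - 2 * r * t + r ^ 2) ≤ 1 * (1 - 2 * r * t + r ^ 2) :=
      mul_le_mul_of_nonneg_right (by linarith) hq.le
    have c3 : |x - y| * ((1 - r ^ 2) / 2) ≤ n * (1 - r) * (1 - r) :=
      mul_le_mul c1 (by nlinarith) (by nlinarith) (mul_nonneg (by linarith) (by linarith))
    have c4 : n * (1 - r) * (1 - r) ≤ n * (1 - 2 * r * t + r ^ 2) := by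
      have := mul_le_mul_of_nonneg_left q2 (by linarith : 0 ≤ n)
      linarith
    refine (norm_add_le _ _).trans ?_
    rw [norm_mul (x - y), Real.norm_of_nonneg (mul_nonneg (by linarith) hq.le : 0 ≤ (x + y) / 2 * (1 - 2 * r * t + r ^ 2)),
      Real.norm_of_nonneg (by nlinarith : 0 ≤ (1 - r ^ 2) / 2), Real.norm_eq_abs]
    linarith
  · filter_upwards [ae_restrict_mem measurableSet_Ioo] with t ht
    refine Tendsto.const_mul _ ?_
    have : ContinuousAt (fun r => P n s r t) 1 := by
      unfold P
      refine ContinuousAt.mul (ContinuousAt.add (ContinuousAt.mul ?_ (by fun_prop))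
        (ContinuousAt.mul ?_ (by fun_prop))) ?_
      · exact continuousAt_id.rpow_const (Or.inr (by linarith))
      · exact continuousAt_id.rpow_const (Or.inr (by linarith))
      · refine ContinuousAt.rpow_const (by fun_prop) (Or.inl ?_)
        have := ht.2
        intro h; linarith
    exact this.tendsto.mono_left nhdsWithin_le_nhds

end FSaux

theorem frank_seiringer_constant_eval (N : ℕ) (hN : 2 ≤ N) (s : ℝ) (hs : 0 < s)
    (hs' : s < 1 / 2) :
    2 * (2 * π ^ (((N : ℝ) - 1) / 2) / Gamma (((N : ℝ) - 1) / 2)) *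
      ∫ r in Set.Ioo (0 : ℝ) 1,
        r ^ (2 * s - 1) * (1 - r ^ ((N : ℝ) - 2 * s)) *
          ∫ t in Set.Ioo (-1 : ℝ) 1,
            (1 - t ^ 2) ^ (((N : ℝ) - 3) / 2) / (1 - 2 * r * t + r ^ 2) ^ (((N : ℝ) + 2 * s) / 2)
    = ((N : ℝ) - 2 * s) * π ^ ((N : ℝ) / 2) * Gamma (1 - 2 * s)
        / (s * Gamma (1 - s) * Gamma (((N : ℝ) + 2 - 2 * s) / 2)) := by
  have hn : (2 : ℝ) ≤ N := by exact_mod_cast hN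
  generalize (N : ℝ) = n at *
  have key := FSaux.ftc_nonneg (fun r hr => FSaux.Phi_deriv (s := s) hn hr) (by
    intro r hr
    have h1 := Real.rpow_nonneg hr.1.le (2 * s - 1)
    have h2 := Real.rpow_le_one hr.1.le hr.2.le (by linarith : 0 ≤ n - 2 * s)
    refine mul_nonneg (by linarith) (mul_nonneg (mul_nonneg h1 (by linarith)) ?_)
    refine setIntegral_nonneg measurableSet_Ioo fun t ht => ?_
    have hv : 0 < 1 - t ^ 2 := by nlinarith [ht.1, ht.2]
    exact div_nonneg (Real.rpow_nonneg hv.le _)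
      (Real.rpow_nonneg (FSaux.Q_pos hr.1 hr.2 (Set.Ioo_subset_Icc_self ht)).le _))
    (FSaux.Phi_zero hn hs) (FSaux.Phi_one hn hs hs')
  rw [integral_const_mul, sub_zero] at key
  have key2 := (eq_div_iff (by linarith : 2 * s ≠ 0)).2 ((mul_comm _ _).trans key)
  rw [key2]
  have dup := Real.Gamma_mul_Gamma_add_half (1 / 2 - s)
  rw [show 1 / 2 - s + 1 / 2 = 1 - s by ring, show 2 * (1 / 2 - s) = 1 - 2 * s by ring,
    show 1 - (1 - 2 * s) = 2 * s by ring] at dup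
  have g1 := Gamma_pos_of_pos (by linarith : 0 < (n - 1) / 2)
  have g2 := Gamma_pos_of_pos (by linarith : 0 < 1 - s)
  have g3 := Gamma_pos_of_pos (by linarith : 0 < n / 2 - s)
  have e1 : Gamma ((n + 2 - 2 * s) / 2) = (n / 2 - s) * Gamma (n / 2 - s) := by
    rw [← Real.Gamma_add_one (by linarith)]; congr 1; ring
  have e2 : π ^ (n / 2) = π ^ ((n - 1) / 2) * √π := by
    rw [Real.sqrt_eq_rpow, ← Real.rpow_add Real.pi_pos]; congr 1; ring
  have e3 : Gamma (1 / 2 - s) = Gamma (1 - 2 * s) * 2 ^ (2 * s) * √π / Gamma (1 - s) :=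
    (eq_div_iff g2.ne').2 dup
  have h2 : (0:ℝ) < 2 ^ (2 * s) := Real.rpow_pos_of_pos two_pos _
  rw [e1, e2, e3, Real.rpow_neg two_pos.le]
  have h3 : n / 2 - s ≠ 0 := by linarith
  have h4 : n - 2 * s ≠ 0 := by linarith
  rw [show n / 2 - s = (n - 2 * s) / 2 by ring] at *
  field_simp
  try ring
end
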